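/- arXiv:0811.2854 — 3 statements merged into one kernel-verified Lean document; each statement's English description precedes it below -/
import Mathlib

section
/- Let p, q ∈ (1, ∞) and define r by 1/r = 1/p + 1/q. Suppose there exists a constant C such that ‖ ( Σ_{n∈ℤ} |π_{[n,n+1]}(f,g)|² )^{1/2} ‖_{L^r(ℝ)} ≤ C ‖f‖_{L^p(ℝ)} ‖g‖_{L^q(ℝ)} holds for all f, g ∈ L²(ℝ) whose Fourier transforms are bounded and compactly supported. Then necessarily p ≥ 2 and q ≥ 2. -/
open MeasureTheory Real Set
open scoped ENNReal

/-- The inverse Fourier transform `f(x) = ∫ e^{2πixξ} F(ξ) dξ`; for `F` bounded with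
compact support this is the `L²` function whose Fourier transform is `F`. -/
noncomputable def invFT (F : ℝ → ℂ) (x : ℝ) : ℂ :=
  ∫ ξ : ℝ, Complex.exp (((2 * Real.pi * x * ξ : ℝ) : ℂ) * Complex.I) * F ξ

/-- The bilinear multiplier `π_A(f,g)`, written in terms of the Fourier transforms
`F = f̂` and `G = ĝ`:
`π_A(f,g)(x) = ∫∫ e^{2πix(ξ₁+ξ₂)} F(ξ₁) G(ξ₂) 1_A(ξ₂-ξ₁) dξ₁ dξ₂`. -/
noncomputable def biMulHat (A : Set ℝ) (F G : ℝ → ℂ) (x : ℝ) : ℂ :=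
  ∫ ξ : ℝ × ℝ, Complex.exp (((2 * Real.pi * x * (ξ.1 + ξ.2) : ℝ) : ℂ) * Complex.I) *
    F ξ.1 * G ξ.2 * A.indicator 1 (ξ.2 - ξ.1)


/-- The indicator function of `[0, L]`, as a complex-valued function. -/
noncomputable def box (L : ℝ) : ℝ → ℂ := (Icc 0 L).indicator 1

lemma measurable_box (L : ℝ) : Measurable (box L) :=
  measurable_one.indicator measurableSet_Icc

lemma norm_box_le (L ξ : ℝ) : ‖box L ξ‖ ≤ 1 := by
  unfold box indicator
  split_ifs <;> simp

lemma hasCompactSupport_box (L : ℝ) : HasCompactSupport (box L) :=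
  HasCompactSupport.intro isCompact_Icc fun _ hx => indicator_of_notMem hx _

lemma box_eq_box_one {L : ℝ} (hL : 0 < L) (ξ : ℝ) : box L ξ = box 1 (L⁻¹ * ξ) := by
  unfold box indicator
  have : ξ ∈ Icc 0 L ↔ L⁻¹ * ξ ∈ Icc (0 : ℝ) 1 := by
    rw [mem_Icc, mem_Icc, inv_mul_le_iff₀ hL, mul_one, mul_nonneg_iff_of_pos_left (inv_pos.2 hL)]
  simp only [this, Pi.one_apply]

lemma invFT_box_one (x : ℝ) :
    invFT (box 1) x =
      ∫ ξ in (0 : ℝ)..1, Complex.exp (((2 * Real.pi * x : ℝ) : ℂ) * Complex.I * ξ) := by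
  rw [intervalIntegral.integral_of_le zero_le_one, ← integral_Icc_eq_integral_Ioc,
    ← integral_indicator measurableSet_Icc]
  unfold invFT box
  congr 1 with ξ
  by_cases hξ : ξ ∈ Icc (0 : ℝ) 1
  · simp only [indicator_of_mem hξ, Pi.one_apply, mul_one]
    congr 1
    push_cast
    ring
  · simp only [indicator_of_notMem hξ, mul_zero]

lemma continuous_invFT_box_one : Continuous (invFT (box 1)) := by
  rw [funext invFT_box_one]
  apply intervalIntegral.continuous_parametric_intervalIntegral_of_continuous'
  simp only [Function.uncurry_def]
  fun_prop

lemma invFT_box_one_zero : invFT (box 1) 0 = 1 := by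
  simp [invFT_box_one]

lemma norm_invFT_box_one_le_one (x : ℝ) : ‖invFT (box 1) x‖ ≤ 1 := by
  rw [invFT_box_one]
  refine (intervalIntegral.norm_integral_le_of_norm_le_const (C := 1) fun ξ _ => ?_).trans
    (by simp)
  rw [Complex.norm_exp]
  simp

lemma abs_mul_norm_invFT_box_one_le_one (x : ℝ) : |x| * ‖invFT (box 1) x‖ ≤ 1 := by
  rcases eq_or_ne x 0 with rfl | hx
  · simp
  have hc : ((2 * Real.pi * x : ℝ) : ℂ) * Complex.I ≠ 0 :=
    mul_ne_zero (Complex.ofReal_ne_zero.2 (by positivity)) Complex.I_ne_zero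
  have hexp : ‖Complex.exp (((2 * Real.pi * x : ℝ) : ℂ) * Complex.I)‖ = 1 :=
    Complex.norm_exp_ofReal_mul_I _
  have hnum : ‖Complex.exp (((2 * Real.pi * x : ℝ) : ℂ) * Complex.I) - 1‖ ≤ 2 :=
    (norm_sub_le _ _).trans (by rw [hexp, norm_one]; norm_num)
  rw [invFT_box_one, integral_exp_mul_complex hc]
  simp only [Complex.ofReal_one, mul_one, Complex.ofReal_zero, mul_zero, Complex.exp_zero]
  rw [norm_div, norm_mul, Complex.norm_I, mul_one, Complex.norm_real, Real.norm_eq_abs,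
    abs_mul, abs_of_pos Real.two_pi_pos]
  have hx' : 0 < |x| := abs_pos.2 hx
  rw [← mul_div_assoc, div_le_one (by positivity)]
  nlinarith [Real.pi_gt_three]

lemma norm_invFT_box_one_le (x : ℝ) : ‖invFT (box 1) x‖ ≤ 2 * (1 + ‖x‖)⁻¹ := by
  rw [← div_eq_mul_inv, le_div_iff₀ (by positivity), Real.norm_eq_abs]
  linarith [norm_invFT_box_one_le_one x, abs_mul_norm_invFT_box_one_le_one x]

lemma memLp_invFT_box_one {p : ℝ} (hp : 1 < p) :
    MemLp (invFT (box 1)) (ENNReal.ofReal p) volume := by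
  have hp0 : 0 < p := zero_lt_one.trans hp
  have hmeas : AEStronglyMeasurable (invFT (box 1)) volume :=
    continuous_invFT_box_one.aestronglyMeasurable
  rw [← integrable_norm_rpow_iff hmeas (by simpa using hp0) ENNReal.ofReal_ne_top,
    ENNReal.toReal_ofReal hp0.le]
  have hint : Integrable (fun x : ℝ => (2 : ℝ) ^ p * (1 + ‖x‖) ^ (-p)) volume :=
    (integrable_one_add_norm (by simpa using hp)).const_mul _
  refine hint.mono'
    (continuous_invFT_box_one.norm.rpow_const fun _ => Or.inr hp0.le).aestronglyMeasurable
    (Filter.Eventually.of_forall fun x => ?_)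
  rw [Real.norm_of_nonneg (by positivity), Real.rpow_neg (by positivity),
    ← Real.inv_rpow (by positivity), ← Real.mul_rpow (by positivity) (by positivity)]
  exact Real.rpow_le_rpow (norm_nonneg _) (norm_invFT_box_one_le x) hp0.le

lemma invFT_box {L : ℝ} (hL : 0 < L) (x : ℝ) : invFT (box L) x = L * invFT (box 1) (L * x) := by
  have := Measure.integral_comp_mul_left (fun η : ℝ =>
    Complex.exp (((2 * Real.pi * (L * x) * η : ℝ) : ℂ) * Complex.I) * box 1 η) L⁻¹
  rw [inv_inv, abs_of_pos hL, Complex.real_smul] at this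
  unfold invFT
  rw [← this]
  congr 1 with ξ
  rw [box_eq_box_one hL, show 2 * Real.pi * (L * x) * (L⁻¹ * ξ) = 2 * Real.pi * x * ξ by field_simp]

lemma eLpNorm_invFT_box {L p : ℝ} (hL : 0 < L) (hp : 1 < p) :
    eLpNorm (invFT (box L)) (ENNReal.ofReal p) volume =
      ENNReal.ofReal (L ^ (1 - 1 / p)) * eLpNorm (invFT (box 1)) (ENNReal.ofReal p) volume := by
  have hp0 : 0 < p := zero_lt_one.trans hp
  have hfun : invFT (box L) = (L : ℂ) • (invFT (box 1) ∘ fun x => L * x) := by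
    ext x
    simp [invFT_box hL x]
  rw [hfun, eLpNorm_const_smul,
    ← (measurableEmbedding_mulLeft₀ hL.ne').eLpNorm_map_measure,
    Real.map_volume_mul_left hL.ne', eLpNorm_smul_measure_of_ne_top ENNReal.ofReal_ne_top,
    smul_eq_mul, ← mul_assoc]
  congr 1
  rw [← ofReal_norm, Complex.norm_real, Real.norm_of_nonneg hL.le,
    abs_of_pos (inv_pos.2 hL), ENNReal.toReal_div, ENNReal.toReal_one,
    ENNReal.toReal_ofReal hp0.le, ENNReal.ofReal_rpow_of_pos (inv_pos.2 hL),
    ← ENNReal.ofReal_mul hL.le, Real.inv_rpow hL.le, ← Real.rpow_neg hL.le,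
    sub_eq_add_neg, Real.rpow_add hL, Real.rpow_one]

/-- Shifting the frequency variable turns a unit piece of a long box into a modulated unit box. -/
lemma norm_biMulHat_box {L : ℝ} {n : ℤ} (hn : 0 ≤ n) (hnL : (n : ℝ) + 2 ≤ L) (x : ℝ) :
    ‖biMulHat (Icc (n : ℝ) (n + 1)) (box 1) (box L) x‖ =
      ‖invFT (box 1) (2 * x)‖ * ‖invFT (box 1) x‖ := by
  have hn' : (0 : ℝ) ≤ n := by exact_mod_cast hn
  set E : ℝ → ℂ := fun t => Complex.exp ((t : ℂ) * Complex.I) with hE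
  have hshear : biMulHat (Icc (n : ℝ) (n + 1)) (box 1) (box L) x =
      ∫ z : ℝ × ℝ, (E (2 * Real.pi * (2 * x) * z.1) * box 1 z.1) *
        (E (2 * Real.pi * x * z.2) * box 1 (z.2 - n)) := by
    unfold biMulHat
    rw [Measure.volume_eq_prod, ← (show MeasurePreserving (MeasurableEquiv.shearAddRight ℝ)
      (volume.prod volume) (volume.prod volume) from
        measurePreserving_prod_add volume volume).integral_comp']
    congr 1 with z
    obtain ⟨a, s⟩ := z
    change E (2 * Real.pi * x * (a + (a + s))) * box 1 a * box L (a + s) *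
      (Icc (n : ℝ) (n + 1)).indicator 1 (a + s - a) =
        (E (2 * Real.pi * (2 * x) * a) * box 1 a) * (E (2 * Real.pi * x * s) * box 1 (s - n))
    have hmul : E (2 * Real.pi * x * (a + (a + s))) =
        E (2 * Real.pi * (2 * x) * a) * E (2 * Real.pi * x * s) := by
      simp only [hE]
      rw [← Complex.exp_add]
      congr 1
      push_cast
      ring
    have hshift : (Icc (n : ℝ) (n + 1)).indicator (1 : ℝ → ℂ) (a + s - a) = box 1 (s - n) := by
      have : a + s - a ∈ Icc (n : ℝ) (n + 1) ↔ s - n ∈ Icc (0 : ℝ) 1 := by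
        simp only [mem_Icc]
        constructor <;> rintro ⟨h₁, h₂⟩ <;> constructor <;> linarith
      unfold box indicator
      simp only [this, Pi.one_apply]
    rw [hmul, hshift]
    by_cases ha : a ∈ Icc (0 : ℝ) 1
    · by_cases hs : s - n ∈ Icc (0 : ℝ) 1
      · have hmem : a + s ∈ Icc 0 L := by
          rw [mem_Icc] at ha hs ⊢
          constructor <;> linarith [ha.1, ha.2, hs.1, hs.2]
        have hL : box L (a + s) = 1 := by rw [box, indicator_of_mem hmem, Pi.one_apply]
        rw [hL]
        ring
      · have : box 1 (s - n) = 0 := indicator_of_notMem hs _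
        simp [this]
    · have : box 1 a = 0 := indicator_of_notMem ha _
      simp [this]
  have hmod : ∫ s : ℝ, E (2 * Real.pi * x * s) * box 1 (s - n) =
      E (2 * Real.pi * x * n) * invFT (box 1) x := by
    rw [← integral_add_right_eq_self _ (n : ℝ), invFT, ← integral_const_mul]
    congr 1 with s
    rw [add_sub_cancel_right, ← mul_assoc]
    congr 1
    simp only [hE]
    rw [← Complex.exp_add]
    congr 1
    push_cast
    ring
  rw [hshear, Measure.volume_eq_prod,
    integral_prod_mul (fun a => E (2 * Real.pi * (2 * x) * a) * box 1 a)
      (fun s => E (2 * Real.pi * x * s) * box 1 (s - n)), hmod, norm_mul, norm_mul,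
    Complex.norm_exp_ofReal_mul_I, one_mul]
  rfl

lemma biMulHat_box_eq_zero {L : ℝ} {n : ℤ} (hn : n ∉ Icc (-2) ⌈L⌉) (x : ℝ) :
    biMulHat (Icc (n : ℝ) (n + 1)) (box 1) (box L) x = 0 := by
  unfold biMulHat
  rw [← integral_zero (ℝ × ℝ) ℂ]
  congr 1 with ξ
  by_cases h₁ : ξ.1 ∈ Icc (0 : ℝ) 1
  · by_cases h₂ : ξ.2 ∈ Icc 0 L
    · have : ξ.2 - ξ.1 ∉ Icc (n : ℝ) (n + 1) := by
        rintro ⟨h₃, h₄⟩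
        refine hn ⟨?_, ?_⟩
        · have : (-2 : ℝ) ≤ n := by linarith [h₁.1, h₁.2, h₂.1, h₂.2]
          exact_mod_cast this
        · have : (n : ℝ) ≤ ⌈L⌉ := by linarith [h₁.1, h₁.2, h₂.1, h₂.2, Int.le_ceil L]
          exact_mod_cast this
      rw [indicator_of_notMem this, mul_zero]
    · have : box L ξ.2 = 0 := indicator_of_notMem h₂ _
      simp [this]
  · have : box 1 ξ.1 = 0 := indicator_of_notMem h₁ _
    simp [this]

lemma sqrt_mul_le_squareFunction_box (M : ℕ) (x : ℝ) :
    √M * (‖invFT (box 1) (2 * x)‖ * ‖invFT (box 1) x‖) ≤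
      √(∑' n : ℤ, ‖biMulHat (Icc (n : ℝ) (n + 1)) (box 1) (box (M + 1)) x‖ ^ 2) := by
  have hsum : Summable fun n : ℤ =>
      ‖biMulHat (Icc (n : ℝ) (n + 1)) (box 1) (box (M + 1)) x‖ ^ 2 := by
    refine summable_of_ne_finset_zero (s := Finset.Icc (-2) ⌈(M : ℝ) + 1⌉) fun n hn => ?_
    rw [biMulHat_box_eq_zero (by simpa using hn)]
    simp
  refine Real.le_sqrt_of_sq_le ?_
  refine le_trans (le_of_eq ?_)
    (hsum.sum_le_tsum (Finset.Ico 0 (M : ℤ)) fun n _ => by positivity)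
  rw [mul_pow, Real.sq_sqrt M.cast_nonneg, Finset.sum_congr rfl (fun n hn => ?_),
    Finset.sum_const, Int.card_Ico, sub_zero, Int.toNat_natCast, nsmul_eq_mul]
  rw [Finset.mem_Ico] at hn
  rw [norm_biMulHat_box hn.1]
  have : (n : ℝ) + 1 ≤ M := by exact_mod_cast hn.2
  linarith

lemma biMulHat_swap (A : Set ℝ) (F G : ℝ → ℂ) (x : ℝ) :
    biMulHat A F G x = biMulHat (-A) G F x := by
  unfold biMulHat
  rw [Measure.volume_eq_prod, ← integral_prod_swap]
  congr 1 with z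
  have : A.indicator (1 : ℝ → ℂ) (z.1 - z.2) = (-A).indicator 1 (z.2 - z.1) := by
    have hmem : z.1 - z.2 ∈ A ↔ z.2 - z.1 ∈ -A := by rw [Set.mem_neg, neg_sub]
    by_cases h : z.1 - z.2 ∈ A
    · rw [indicator_of_mem h, indicator_of_mem (hmem.1 h), Pi.one_apply, Pi.one_apply]
    · rw [indicator_of_notMem h, indicator_of_notMem (mt hmem.2 h)]
  simp only [Prod.fst_swap, Prod.snd_swap, this]
  rw [add_comm z.2 z.1]
  ring

lemma tsum_biMulHat_swap (F G : ℝ → ℂ) (x : ℝ) :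
    ∑' n : ℤ, ‖biMulHat (Icc (n : ℝ) (n + 1)) F G x‖ ^ 2 =
      ∑' n : ℤ, ‖biMulHat (Icc (n : ℝ) (n + 1)) G F x‖ ^ 2 := by
  rw [← (Equiv.subLeft (-1 : ℤ)).tsum_eq]
  congr 1 with n
  rw [biMulHat_swap, Set.neg_Icc, Equiv.subLeft_apply]
  push_cast
  ring_nf

lemma two_le_right_exponent_of_bound_box {p q r C : ℝ} (hp : 1 < p) (hq : 1 < q) (hr : 0 < r)
    (h : ∀ L : ℝ, eLpNorm (fun x : ℝ =>
          √(∑' n : ℤ, ‖biMulHat (Icc (n : ℝ) (n + 1)) (box 1) (box L) x‖ ^ 2))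
          (ENNReal.ofReal r) volume ≤
        ENNReal.ofReal C * eLpNorm (invFT (box 1)) (ENNReal.ofReal p) volume *
          eLpNorm (invFT (box L)) (ENNReal.ofReal q) volume) :
    2 ≤ q := by
  by_contra! hq2
  set K : ℝ → ℝ := fun x => ‖invFT (box 1) (2 * x)‖ * ‖invFT (box 1) x‖ with hK
  have hKcont : Continuous K :=
    (continuous_invFT_box_one.comp (continuous_const_mul 2)).norm.mul
      continuous_invFT_box_one.norm
  set κ := eLpNorm K (ENNReal.ofReal r) volume with hκ
  have hκ0 : κ ≠ 0 := by
    rw [hκ, Ne, eLpNorm_eq_zero_iff hKcont.aestronglyMeasurable (by simpa using hr),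
      hKcont.ae_eq_iff_eq volume continuous_zero]
    intro h0
    have := congrFun h0 0
    simp [hK, invFT_box_one_zero] at this
  set D := ENNReal.ofReal C * eLpNorm (invFT (box 1)) (ENNReal.ofReal p) volume *
    eLpNorm (invFT (box 1)) (ENNReal.ofReal q) volume with hD
  have hDtop : D ≠ ⊤ :=
    ENNReal.mul_ne_top (ENNReal.mul_ne_top ENNReal.ofReal_ne_top
      (memLp_invFT_box_one hp).eLpNorm_ne_top) (memLp_invFT_box_one hq).eLpNorm_ne_top
  have key (M : ℕ) :
      ENNReal.ofReal √M * κ ≤ ENNReal.ofReal (((M : ℝ) + 1) ^ (1 - 1 / q)) * D := by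
    calc ENNReal.ofReal √M * κ = eLpNorm (√M • K) (ENNReal.ofReal r) volume := by
          rw [eLpNorm_const_smul, ← ofReal_norm, Real.norm_of_nonneg (Real.sqrt_nonneg _)]
      _ ≤ _ := by
          refine eLpNorm_mono_real fun x => ?_
          rw [Pi.smul_apply, smul_eq_mul, Real.norm_of_nonneg (by positivity)]
          exact sqrt_mul_le_squareFunction_box M x
      _ ≤ _ := h _
      _ = _ := by
          rw [eLpNorm_invFT_box (by positivity) hq, hD]
          ring
  have hκtop : κ ≠ ⊤ := by
    intro htop
    have := key 1
    rw [htop, Nat.cast_one, Real.sqrt_one, ENNReal.ofReal_one, one_mul, top_le_iff] at this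
    exact ENNReal.mul_ne_top ENNReal.ofReal_ne_top hDtop this
  have hκpos : 0 < κ.toReal := ENNReal.toReal_pos hκ0 hκtop
  have hexp : 0 < 1 / q - 1 / 2 := by
    have := one_div_lt_one_div_of_lt (zero_lt_one.trans hq) hq2
    linarith
  have hbound (M : ℕ) (hM : 1 ≤ M) :
      (M : ℝ) ^ (1 / q - 1 / 2) ≤ 2 ^ (1 - 1 / q) * D.toReal / κ.toReal := by
    have hM' : (1 : ℝ) ≤ M := by exact_mod_cast hM
    have hM0 : (0 : ℝ) < M := by linarith
    have hq1 : 0 ≤ 1 - 1 / q := by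
      rw [sub_nonneg, div_le_one (by linarith)]
      exact hq.le
    have hreal : √M * κ.toReal ≤ ((M : ℝ) + 1) ^ (1 - 1 / q) * D.toReal := by
      have := ENNReal.toReal_mono (ENNReal.mul_ne_top ENNReal.ofReal_ne_top hDtop) (key M)
      rwa [ENNReal.toReal_mul, ENNReal.toReal_mul, ENNReal.toReal_ofReal (by positivity),
        ENNReal.toReal_ofReal (by positivity)] at this
    have hpow : ((M : ℝ) + 1) ^ (1 - 1 / q) ≤ 2 ^ (1 - 1 / q) * (M : ℝ) ^ (1 - 1 / q) := by
      rw [← Real.mul_rpow zero_le_two hM0.le]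
      exact Real.rpow_le_rpow (by positivity) (by linarith) hq1
    have hsplit : √M = (M : ℝ) ^ (1 / q - 1 / 2) * (M : ℝ) ^ (1 - 1 / q) := by
      rw [← Real.rpow_add hM0, Real.sqrt_eq_rpow]
      congr 1
      ring
    rw [le_div_iff₀ hκpos]
    refine le_of_mul_le_mul_right ?_ (Real.rpow_pos_of_pos hM0 (1 - 1 / q))
    calc _ = √M * κ.toReal := by rw [hsplit]; ring
      _ ≤ _ := hreal.trans (mul_le_mul_of_nonneg_right hpow ENNReal.toReal_nonneg)
      _ = _ := by ring
  have htend := (tendsto_rpow_atTop hexp).comp (tendsto_natCast_atTop_atTop (R := ℝ))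
  obtain ⟨M, hMlarge, hM⟩ := ((htend.eventually_gt_atTop _).and
    (Filter.eventually_ge_atTop 1)).exists
  exact (hbound M hM).not_gt hMlarge

/-- **necessity of `p, q ≥ 2`.** If for some `p, q ∈ (1,∞)` and
`1/r = 1/p + 1/q` the square-function estimate for the intervals `[n, n+1]` holds for
all `f, g ∈ L²` with bounded compactly supported Fourier transforms (here encoded by
`f = invFT F`, `g = invFT G` with `F, G` measurable, bounded and compactly supported),
then necessarily `p ≥ 2` and `q ≥ 2`. -/
theorem necessity_of_p_q_ge_two
    (p q r : ℝ) (hp : 1 < p) (hq : 1 < q) (hr : 1 / r = 1 / p + 1 / q)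
    (h : ∃ C : ℝ, ∀ F G : ℝ → ℂ, Measurable F → Measurable G →
      (∃ M : ℝ, ∀ ξ : ℝ, ‖F ξ‖ ≤ M) → (∃ M : ℝ, ∀ ξ : ℝ, ‖G ξ‖ ≤ M) →
      HasCompactSupport F → HasCompactSupport G →
      eLpNorm (fun x : ℝ =>
          Real.sqrt (∑' n : ℤ, ‖biMulHat (Set.Icc (n : ℝ) ((n : ℝ) + 1)) F G x‖ ^ 2))
          (ENNReal.ofReal r) volume ≤
        ENNReal.ofReal C * eLpNorm (invFT F) (ENNReal.ofReal p) volume *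
          eLpNorm (invFT G) (ENNReal.ofReal q) volume) :
    2 ≤ p ∧ 2 ≤ q := by
  obtain ⟨C, hC⟩ := h
  have hr0 : 0 < r := by
    rw [← one_div_pos, hr]
    positivity
  have hbox (L L' : ℝ) := hC (box L) (box L') (measurable_box L) (measurable_box L')
    ⟨1, norm_box_le L⟩ ⟨1, norm_box_le L'⟩ (hasCompactSupport_box L) (hasCompactSupport_box L')
  refine ⟨two_le_right_exponent_of_bound_box (C := C) hq hp hr0 fun L => ?_,
    two_le_right_exponent_of_bound_box (C := C) hp hq hr0 fun L => hbox 1 L⟩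
  simp_rw [tsum_biMulHat_swap (box 1) (box L)]
  rw [mul_right_comm]
  exact hbox L 1
end

section
/- (Carleson) Let p ∈ [2, ∞). There exists a constant c = c_p such that for every Schwartz function f on ℝ, ‖ ( Σ_{n∈ℤ} |π_{[n,n+1]}(f)|² )^{1/2} ‖_{L^p(ℝ)} ≤ c ‖f‖_{L^p(ℝ)}. -/
open MeasureTheory Real Set
open scoped ENNReal

/-- The Fourier transform `f̂(ξ) = ∫ f(t) e^{-2πitξ} dt`. -/
noncomputable def FT (f : ℝ → ℂ) (ξ : ℝ) : ℂ :=
  ∫ t : ℝ, Complex.exp (((-2 * Real.pi * t * ξ : ℝ) : ℂ) * Complex.I) * f t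

/-- The linear Fourier multiplier `π_A(f)(x) = ∫ e^{2πixξ} f̂(ξ) 1_A(ξ) dξ`. -/
noncomputable def linMul (A : Set ℝ) (f : ℝ → ℂ) (x : ℝ) : ℂ :=
  ∫ ξ : ℝ, Complex.exp (((2 * Real.pi * x * ξ : ℝ) : ℂ) * Complex.I) *
    FT f ξ * A.indicator 1 ξ

/-- Jensen's inequality for a weighted sum. -/
theorem tsum_mul_rpow_le {ι : Type*} [MeasurableSpace ι] [MeasurableSingletonClass ι] [Countable ι]
    (E A : ι → ℝ≥0∞) {p : ℝ} (hp : 1 ≤ p) :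
    (∑' k, E k * A k) ^ p ≤ (∑' k, E k) ^ (p - 1) * ∑' k, E k * A k ^ p := by
  have hp0 : 0 < p := by linarith
  have hq : 0 ≤ 1 - p⁻¹ := sub_nonneg.mpr (inv_le_one_of_one_le₀ hp)
  have h := ENNReal.lintegral_mul_norm_pow_le (μ := Measure.count) (f := E)
    (g := fun k => E k * A k ^ p) (measurable_of_countable _).aemeasurable
    (measurable_of_countable _).aemeasurable hq (inv_nonneg.mpr hp0.le) (by ring)
  have e : ∀ k, E k ^ (1 - p⁻¹) * (E k * A k ^ p) ^ p⁻¹ = E k * A k := by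
    intro k
    rw [ENNReal.mul_rpow_of_nonneg _ _ (inv_nonneg.mpr hp0.le), ← mul_assoc,
      ← ENNReal.rpow_add_of_nonneg _ _ hq (inv_nonneg.mpr hp0.le), ENNReal.rpow_rpow_inv hp0.ne']
    simp
  simp only [e, lintegral_count] at h
  calc _ ≤ _ := ENNReal.rpow_le_rpow h hp0.le
    _ = _ := by
      rw [ENNReal.mul_rpow_of_nonneg _ _ hp0.le, ENNReal.rpow_inv_rpow hp0.ne', ← ENNReal.rpow_mul]
      congr 2
      field_simp

/-- Young's inequality for the convolution of an `ℓ¹` sequence with an `ℓᵖ` sequence. -/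
theorem tsum_convolution_rpow_le (E A : ℤ → ℝ≥0∞) {p : ℝ} (hp : 1 ≤ p) :
    ∑' m, (∑' k, E k * A (m - k)) ^ p ≤ (∑' k, E k) ^ p * ∑' j, A j ^ p := by
  calc _ ≤ ∑' m, (∑' k, E k) ^ (p - 1) * ∑' k, E k * A (m - k) ^ p :=
        ENNReal.tsum_le_tsum fun m => tsum_mul_rpow_le E _ hp
    _ = (∑' k, E k) ^ (p - 1) * ((∑' k, E k) * ∑' j, A j ^ p) := by
      rw [ENNReal.tsum_mul_left, ENNReal.tsum_comm, ← ENNReal.tsum_mul_right]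
      congr 2 with k
      rw [ENNReal.tsum_mul_left]
      congr 1
      exact (Equiv.subRight k).tsum_eq fun j => A j ^ p
    _ = _ := by
      rw [← mul_assoc]
      congr 1
      nth_rw 2 [← ENNReal.rpow_one (∑' k, E k)]
      rw [← ENNReal.rpow_add_of_nonneg _ _ (by linarith) zero_le_one]
      simp

/-- The discrete Hilbert transform of the restriction of `a` to `s`. -/
noncomputable def discreteHilbert (s : Finset ℤ) (a : ℤ → ℂ) (m : ℤ) : ℂ :=
  ∑ j ∈ s, a j * ((m - j : ℤ) : ℂ)⁻¹

/-- The discrete Hilbert transform satisfies a bound on `ℓᵖ`. -/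
def HilbertBound (p : ℝ) : Prop :=
  ∃ C : ℝ≥0∞, C ≠ ∞ ∧ ∀ (s : Finset ℤ) (a : ℤ → ℂ),
    ∑' m, ‖discreteHilbert s a m‖ₑ ^ p ≤ C * ∑ j ∈ s, ‖a j‖ₑ ^ p

theorem bernoulliFun_one_eq (x : ℝ) : bernoulliFun 1 x = x - 1 / 2 := by
  simp

theorem Continuous.memLp_two_Ioc {v : ℝ → ℂ} (hv : Continuous v) :
    MemLp v 2 (volume.restrict (Ioc (0:ℝ) 1)) := by
  obtain ⟨C, hC⟩ := isCompact_Icc.exists_bound_of_continuousOn (hv.continuousOn (s := Icc (0:ℝ) 1))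
  exact MemLp.of_bound hv.aestronglyMeasurable C
    ((ae_restrict_iff' measurableSet_Ioc).mpr (ae_of_all _ fun t ht => hC t ⟨ht.1.le, ht.2⟩))

theorem summable_and_tsum_norm_sq_discreteHilbert_le (s : Finset ℤ) (a : ℤ → ℂ) :
    Summable (fun m => ‖discreteHilbert s a m‖ ^ 2) ∧
    ∑' m, ‖discreteHilbert s a m‖ ^ 2 ≤ π ^ 2 * ∑ j ∈ s, ‖a j‖ ^ 2 := by
  set g : ℝ → ℂ := fun t => ∑ j ∈ s, a j * fourier j (t : AddCircle (1 - 0 : ℝ)) with hg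
  set u : ℝ → ℂ := fun t => (bernoulliFun 1 t : ℂ) * g t with hu
  have hB : Continuous fun t : ℝ => ((bernoulliFun 1 t : ℝ) : ℂ) := by
    simp only [bernoulliFun_one_eq]; fun_prop
  have hfc : ∀ j : ℤ, Continuous fun t : ℝ => fourier j (t : AddCircle (1 - 0 : ℝ)) := fun j =>
    (map_continuous _).comp (AddCircle.continuous_mk' _)
  have hgc : Continuous g := by fun_prop
  have huc : Continuous u := hB.mul hgc
  have h01 : (0:ℝ) < 1 := one_pos
  have hfg : ∀ n, fourierCoeffOn h01 g n = ∑ j ∈ s, a j * (if j = n then 1 else 0) := by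
    intro n
    rw [fourierCoeffOn_eq_integral]
    simp only [hg, smul_eq_mul, Finset.mul_sum]
    rw [intervalIntegral.integral_finsetSum fun j _ => by
      apply Continuous.intervalIntegrable; fun_prop]
    rw [Finset.smul_sum]
    refine Finset.sum_congr rfl fun j _ => ?_
    have : Fact ((0:ℝ) < 1 - 0) := ⟨by norm_num⟩
    have h1 := fourierCoeff_eq_intervalIntegral (T := (1 - 0 : ℝ)) (fourier j) n 0
    rw [fourierCoeff_fourier] at h1
    simp only [Pi.single_apply, eq_comm (a := n)] at h1
    rw [h1, mul_smul_comm, ← intervalIntegral.integral_const_mul]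
    simp [mul_left_comm]
  have hfu : ∀ n, fourierCoeffOn h01 u n = -(2 * π * Complex.I)⁻¹ * discreteHilbert s a n := by
    intro n
    rw [fourierCoeffOn_eq_integral]
    simp only [hu, hg, smul_eq_mul, Finset.mul_sum]
    rw [intervalIntegral.integral_finsetSum fun j _ => by
      apply Continuous.intervalIntegrable; fun_prop]
    rw [Finset.smul_sum, discreteHilbert, Finset.mul_sum]
    refine Finset.sum_congr rfl fun j _ => ?_
    have h1 := bernoulliFourierCoeff_eq one_ne_zero (n - j)
    rw [bernoulliFourierCoeff, fourierCoeffOn_eq_integral] at h1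
    have h2 : ∀ x : ℝ, fourier (-n) (x : AddCircle (1 - 0 : ℝ)) *
        ((bernoulliFun 1 x : ℂ) * (a j * fourier j (x : AddCircle (1 - 0 : ℝ)))) =
        a j * (fourier (-(n - j)) (x : AddCircle (1 - 0 : ℝ)) • (bernoulliFun 1 x : ℂ)) := by
      intro x
      rw [show -(n - j) = -n + j by ring, fourier_add, smul_eq_mul]
      ring
    simp only [h2, intervalIntegral.integral_const_mul]
    rw [← mul_smul_comm, h1]
    push_cast
    simp only [Nat.factorial_one, pow_one, Nat.cast_one, neg_div, one_div, mul_inv]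
    ring
  have Pg := hasSum_sq_fourierCoeffOn h01 hgc.memLp_two_Ioc
  have Pu := hasSum_sq_fourierCoeffOn h01 huc.memLp_two_Ioc
  have Eg : (1 - 0 : ℝ)⁻¹ • ∫ x in (0:ℝ)..1, ‖g x‖ ^ 2 = ∑ j ∈ s, ‖a j‖ ^ 2 := by
    rw [← Pg.tsum_eq, tsum_eq_sum (s := s)]
    · refine Finset.sum_congr rfl fun j hj => ?_
      simp [hfg, hj]
    · intro j hj
      simp [hfg, hj]
  have hle : (1 - 0 : ℝ)⁻¹ • ∫ x in (0:ℝ)..1, ‖u x‖ ^ 2 ≤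
      4⁻¹ * ∑ j ∈ s, ‖a j‖ ^ 2 := by
    rw [← Eg, mul_smul_comm, ← intervalIntegral.integral_const_mul]
    simp only [sub_zero, inv_one, one_smul]
    refine intervalIntegral.integral_mono_on zero_le_one
      (Continuous.intervalIntegrable (by fun_prop) _ _)
      (Continuous.intervalIntegrable (by fun_prop) _ _) fun x hx => ?_
    rw [hu, norm_mul, mul_pow, Complex.norm_real, Real.norm_eq_abs, sq_abs, bernoulliFun_one_eq]
    gcongr
    nlinarith [hx.1, hx.2]
  have key : ∀ n, ‖fourierCoeffOn h01 u n‖ ^ 2 =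
      (4 * π ^ 2)⁻¹ * ‖discreteHilbert s a n‖ ^ 2 := by
    intro n
    rw [hfu, norm_mul, mul_pow]
    congr 1
    simp [mul_pow, abs_of_pos pi_pos]
    ring
  simp only [key] at Pu
  have h4 : (4 * π ^ 2)⁻¹ ≠ 0 := by positivity
  refine ⟨(summable_mul_left_iff h4).mp Pu.summable, ?_⟩
  have h5 := Pu.tsum_eq
  rw [tsum_mul_left] at h5
  rw [← h5, ← div_eq_inv_mul, div_le_iff₀ (by positivity)] at hle
  refine hle.trans_eq ?_
  ring

theorem hilbertBound_two : HilbertBound 2 := by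
  refine ⟨ENNReal.ofReal (π ^ 2), ENNReal.ofReal_ne_top, fun s a => ?_⟩
  have e : ∀ z : ℂ, ‖z‖ₑ ^ (2:ℝ) = ENNReal.ofReal (‖z‖ ^ 2) := by
    intro z
    rw [← ofReal_norm, ENNReal.rpow_ofNat, ENNReal.ofReal_pow (norm_nonneg _)]
  obtain ⟨h1, h2⟩ := summable_and_tsum_norm_sq_discreteHilbert_le s a
  simp only [e]
  rw [← ENNReal.ofReal_tsum_of_nonneg (fun _ => by positivity) h1,
    ← ENNReal.ofReal_sum_of_nonneg (fun _ _ => by positivity),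
    ← ENNReal.ofReal_mul (by positivity)]
  exact ENNReal.ofReal_le_ofReal h2

theorem inv_mul_inv_int_sub (m j k : ℤ) :
    ((m - j : ℤ) : ℂ)⁻¹ * ((m - k : ℤ) : ℂ)⁻¹ =
      ((j - k : ℤ) : ℂ)⁻¹ * ((m - j : ℤ) : ℂ)⁻¹ + ((k - j : ℤ) : ℂ)⁻¹ * ((m - k : ℤ) : ℂ)⁻¹ +
      (if j = k then ((m - j : ℤ) : ℂ)⁻¹ ^ 2 else 0) +
      (if m = j then ((m - k : ℤ) : ℂ)⁻¹ ^ 2 else 0) +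
      (if m = k then ((m - j : ℤ) : ℂ)⁻¹ ^ 2 else 0) := by
  by_cases hjk : j = k
  · subst hjk
    by_cases hm : m = j
    · subst hm; simp
    · simp [hm, sq]
  by_cases hmj : m = j
  · subst hmj
    simp [hjk, -inv_pow]
    rw [← neg_sub (m : ℂ) k, inv_neg]
    ring
  by_cases hmk : m = k
  · subst hmk
    simp [hjk, hmj, -inv_pow]
    rw [← neg_sub (m : ℂ) j, inv_neg]
    ring
  have h1 : ((m : ℂ) - j) ≠ 0 := sub_ne_zero.mpr (by exact_mod_cast hmj)
  have h2 : ((m : ℂ) - k) ≠ 0 := sub_ne_zero.mpr (by exact_mod_cast hmk)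
  have h3 : ((j : ℂ) - k) ≠ 0 := sub_ne_zero.mpr (by exact_mod_cast hjk)
  have h4 : ((k : ℂ) - j) ≠ 0 := sub_ne_zero.mpr (by exact_mod_cast (Ne.symm hjk))
  simp only [hjk, hmj, hmk, if_false, add_zero]
  push_cast
  rw [← neg_sub (j : ℂ) k, inv_neg]
  field_simp
  ring

/-- Cotlar's identity for the discrete Hilbert transform. -/
theorem discreteHilbert_sq (s : Finset ℤ) (a : ℤ → ℂ) (m : ℤ) :
    discreteHilbert s a m ^ 2 =
      2 * discreteHilbert s (fun j => a j * discreteHilbert s a j) m +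
      ∑ j ∈ s, a j ^ 2 * ((m - j : ℤ) : ℂ)⁻¹ ^ 2 +
      2 * ((if m ∈ s then a m else 0) * ∑ j ∈ s, a j * ((m - j : ℤ) : ℂ)⁻¹ ^ 2) := by
  have e : discreteHilbert s a m ^ 2 = ∑ j ∈ s, ∑ k ∈ s,
      ((a j * (a k * ((j - k : ℤ) : ℂ)⁻¹)) * ((m - j : ℤ) : ℂ)⁻¹ +
       (a k * (a j * ((k - j : ℤ) : ℂ)⁻¹)) * ((m - k : ℤ) : ℂ)⁻¹ +
       (if j = k then a j * a k * ((m - j : ℤ) : ℂ)⁻¹ ^ 2 else 0) +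
       (if m = j then a j * a k * ((m - k : ℤ) : ℂ)⁻¹ ^ 2 else 0) +
       (if m = k then a j * a k * ((m - j : ℤ) : ℂ)⁻¹ ^ 2 else 0)) := by
    rw [sq, discreteHilbert, Finset.sum_mul_sum]
    refine Finset.sum_congr rfl fun j _ => Finset.sum_congr rfl fun k _ => ?_
    have := congrArg (fun z => a j * a k * z) (inv_mul_inv_int_sub m j k)
    simp only [mul_add, mul_ite, mul_zero] at this
    rw [mul_mul_mul_comm, this]
    ring_nf
  have h1 : ∑ j ∈ s, ∑ k ∈ s, (a j * (a k * ((j - k : ℤ) : ℂ)⁻¹)) * ((m - j : ℤ) : ℂ)⁻¹ =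
      discreteHilbert s (fun j => a j * discreteHilbert s a j) m := by
    simp only [discreteHilbert, Finset.mul_sum, Finset.sum_mul]
  rw [e]
  simp only [Finset.sum_add_distrib]
  rw [h1, Finset.sum_comm (f := fun j k =>
    (a k * (a j * ((k - j : ℤ) : ℂ)⁻¹)) * ((m - k : ℤ) : ℂ)⁻¹), h1]
  have h2 : ∑ j ∈ s, ∑ k ∈ s, (if j = k then a j * a k * ((m - j : ℤ) : ℂ)⁻¹ ^ 2 else 0) =
      ∑ j ∈ s, a j ^ 2 * ((m - j : ℤ) : ℂ)⁻¹ ^ 2 := by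
    refine Finset.sum_congr rfl fun j hj => ?_
    rw [Finset.sum_ite_eq, if_pos hj, sq (a j)]
  have h3 : ∑ j ∈ s, ∑ k ∈ s, (if m = j then a j * a k * ((m - k : ℤ) : ℂ)⁻¹ ^ 2 else 0) =
      (if m ∈ s then a m else 0) * ∑ j ∈ s, a j * ((m - j : ℤ) : ℂ)⁻¹ ^ 2 := by
    rw [Finset.sum_comm, Finset.mul_sum]
    refine Finset.sum_congr rfl fun j hj => ?_
    rw [Finset.sum_ite_eq]
    split_ifs <;> ring
  have h4 : ∑ j ∈ s, ∑ k ∈ s, (if m = k then a j * a k * ((m - j : ℤ) : ℂ)⁻¹ ^ 2 else 0) =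
      (if m ∈ s then a m else 0) * ∑ j ∈ s, a j * ((m - j : ℤ) : ℂ)⁻¹ ^ 2 := by
    rw [Finset.mul_sum]
    refine Finset.sum_congr rfl fun j hj => ?_
    rw [Finset.sum_ite_eq]
    split_ifs <;> ring
  rw [h2, h3, h4]
  ring

/-- The restriction of a convolution kernel to a finite set obeys Young's inequality. -/
theorem tsum_enorm_sum_rpow_le (E : ℤ → ℂ) (s : Finset ℤ) (a : ℤ → ℂ) {p : ℝ} (hp : 1 ≤ p) :
    ∑' m, ‖∑ j ∈ s, a j * E (m - j)‖ₑ ^ p ≤ (∑' k, ‖E k‖ₑ) ^ p * ∑ j ∈ s, ‖a j‖ₑ ^ p := by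
  have hp0 : 0 < p := by linarith
  set A : ℤ → ℝ≥0∞ := fun j => if j ∈ s then ‖a j‖ₑ else 0 with hA
  have h1 : ∀ m, ‖∑ j ∈ s, a j * E (m - j)‖ₑ ≤ ∑' k, ‖E k‖ₑ * A (m - k) := by
    intro m
    calc _ ≤ ∑ j ∈ s, ‖a j * E (m - j)‖ₑ := enorm_sum_le _ _
      _ = ∑' j, A j * ‖E (m - j)‖ₑ := by
        rw [tsum_eq_sum (s := s)]
        · exact Finset.sum_congr rfl fun j hj => by simp [hA, hj, enorm_mul]
        · intro j hj
          simp [hA, hj]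
      _ = ∑' k, ‖E k‖ₑ * A (m - k) := by
        rw [← (Equiv.subLeft m).tsum_eq]
        exact tsum_congr fun k => by simp [mul_comm]
  calc _ ≤ ∑' m, (∑' k, ‖E k‖ₑ * A (m - k)) ^ p :=
        ENNReal.tsum_le_tsum fun m => ENNReal.rpow_le_rpow (h1 m) hp0.le
    _ ≤ _ := tsum_convolution_rpow_le _ A hp
    _ = _ := by
      rw [tsum_eq_sum (f := fun j => A j ^ p) (s := s)]
      · congr 1
        exact Finset.sum_congr rfl fun j hj => by simp [hA, hj]
      · intro j hj
        simp [hA, hj, hp0]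

theorem ENNReal.add_add_rpow_le (x y z : ℝ≥0∞) {p : ℝ} (hp : 1 ≤ p) :
    (x + y + z) ^ p ≤ 2 ^ (p - 1) * 2 ^ (p - 1) * (x ^ p + y ^ p + z ^ p) := by
  have h1 : (1 : ℝ≥0∞) ≤ 2 ^ (p - 1) := by
    simpa using ENNReal.rpow_le_rpow_of_exponent_le one_le_two (sub_nonneg.mpr hp)
  calc _ ≤ _ := ENNReal.rpow_add_le_mul_rpow_add_rpow _ _ hp
    _ ≤ 2 ^ (p - 1) * (2 ^ (p - 1) * (x ^ p + y ^ p) + 2 ^ (p - 1) * z ^ p) := by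
      gcongr
      · exact ENNReal.rpow_add_le_mul_rpow_add_rpow _ _ hp
      · exact le_mul_of_one_le_left' h1
    _ = _ := by ring

theorem ENNReal.mul_le_mul_sq_add (u v : ℝ≥0∞) {e : ℝ≥0∞} (h0 : e ≠ 0) (h1 : e ≠ ∞) :
    u * v ≤ e * v ^ 2 + e⁻¹ * u ^ 2 := by
  rcases le_total u (e * v) with h | h
  · refine le_add_right ?_
    calc u * v ≤ e * v * v := by gcongr
      _ = _ := by ring
  · refine le_add_left ?_
    have h' : v ≤ e⁻¹ * u := by
      rw [← one_mul v, ← ENNReal.inv_mul_cancel h0 h1, mul_assoc]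
      gcongr
    calc u * v ≤ u * (e⁻¹ * u) := by gcongr
      _ = _ := by ring

theorem tsum_enorm_inv_sq_ne_top : ∑' k : ℤ, ‖((k : ℂ)⁻¹ ^ 2)‖ₑ ≠ ∞ := by
  have h : Summable fun k : ℤ => ‖((k : ℂ)⁻¹ ^ 2)‖ := by
    simpa [one_div] using Real.summable_one_div_int_pow.mpr one_lt_two
  simpa only [ofReal_norm] using h.tsum_ofReal_ne_top

theorem HilbertBound.two_mul {p : ℝ} (hp : 1 ≤ p) (h : HilbertBound p) :
    HilbertBound (2 * p) := by
  obtain ⟨C, hC, hb⟩ := h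
  have hp0 : 0 < p := by linarith
  set κ : ℝ≥0∞ := ∑' k : ℤ, ‖((k : ℂ)⁻¹ ^ 2)‖ₑ with hκ
  have hκt : κ ≠ ∞ := tsum_enorm_inv_sq_ne_top
  have hsq : ∀ x : ℝ≥0∞, x ^ (2 * p) = (x ^ p) ^ 2 := fun x => by
    rw [mul_comm, ENNReal.rpow_mul, ENNReal.rpow_ofNat]
  have h2t : ∀ r : ℝ, (2:ℝ≥0∞) ^ r ≠ ∞ := fun r =>
    ENNReal.rpow_ne_top_of_ne_zero (by norm_num) (by norm_num)
  set K : ℝ≥0∞ := 2 ^ (p - 1) * 2 ^ (p - 1) with hK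
  have hKt : K ≠ ∞ := ENNReal.mul_ne_top (h2t _) (h2t _)
  set L : ℝ≥0∞ := K * (2 ^ p * C) with hL
  have hLt : L ≠ ∞ := ENNReal.mul_ne_top hKt (ENNReal.mul_ne_top (h2t _) hC)
  set ε : ℝ≥0∞ := (2 * (L + 1))⁻¹ with hε
  have hL1 : 2 * (L + 1) ≠ ∞ := by finiteness
  have hε0 : ε ≠ 0 := ENNReal.inv_ne_zero.mpr hL1
  have hεt : ε ≠ ∞ := ENNReal.inv_ne_top.mpr (by simp)
  have hLε : L * ε ≤ 2⁻¹ := by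
    rw [hε, ENNReal.mul_inv (by simp) (by simp), mul_left_comm]
    refine mul_le_of_le_one_right' ?_
    rw [← div_eq_mul_inv]
    exact ENNReal.div_le_of_le_mul (by simp)
  set D : ℝ≥0∞ := L * ε⁻¹ + K * κ ^ p + K * (2 ^ p * (1 + κ ^ (2 * p))) with hD
  have hDt : D ≠ ∞ := by
    have : ε⁻¹ ≠ ∞ := ENNReal.inv_ne_top.mpr hε0
    have h3 : κ ^ p ≠ ∞ := ENNReal.rpow_ne_top_of_nonneg hp0.le hκt
    have h4 : κ ^ (2 * p) ≠ ∞ := ENNReal.rpow_ne_top_of_nonneg (by positivity) hκt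
    have h5 := h2t p
    finiteness
  refine ⟨2 * D, by finiteness, fun s a => ?_⟩
  set H := discreteHilbert s a with hH
  set X := ∑' m, ‖H m‖ₑ ^ (2 * p) with hX
  set Y := ∑ j ∈ s, ‖a j‖ₑ ^ (2 * p) with hY
  have hXt : X ≠ ∞ := by
    have hV : ∑' m, ‖H m‖ₑ ^ p ≠ ∞ := by
      refine ne_top_of_le_ne_top ?_ (hb s a)
      refine ENNReal.mul_ne_top hC (ENNReal.sum_ne_top.mpr fun j _ => ?_)
      exact ENNReal.rpow_ne_top_of_nonneg hp0.le enorm_ne_top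
    refine ne_top_of_le_ne_top (ENNReal.mul_ne_top hV hV) ?_
    rw [hX, ← ENNReal.tsum_mul_left]
    refine ENNReal.tsum_le_tsum fun m => ?_
    rw [hsq, sq]
    gcongr
    exact ENNReal.le_tsum (f := fun m => ‖H m‖ₑ ^ p) m
  have hT1 : ∑' m, ‖2 * discreteHilbert s (fun j => a j * H j) m‖ₑ ^ p ≤
      2 ^ p * (C * (ε * X + ε⁻¹ * Y)) := by
    simp only [enorm_mul, ENNReal.mul_rpow_of_nonneg _ _ hp0.le, ENNReal.tsum_mul_left]
    rw [show ‖(2:ℂ)‖ₑ = 2 by simp [← ofReal_norm]]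
    gcongr
    refine (hb s _).trans ?_
    gcongr
    calc _ ≤ ∑ j ∈ s, (ε * ‖H j‖ₑ ^ (2 * p) + ε⁻¹ * ‖a j‖ₑ ^ (2 * p)) := by
          refine Finset.sum_le_sum fun j _ => ?_
          rw [enorm_mul, ENNReal.mul_rpow_of_nonneg _ _ hp0.le, hsq, hsq]
          exact ENNReal.mul_le_mul_sq_add _ _ hε0 hεt
      _ ≤ _ := by
          rw [Finset.sum_add_distrib, ← Finset.mul_sum, ← Finset.mul_sum]
          gcongr
          exact ENNReal.sum_le_tsum s
  have hT2 : ∑' m, ‖∑ j ∈ s, a j ^ 2 * ((m - j : ℤ) : ℂ)⁻¹ ^ 2‖ₑ ^ p ≤ κ ^ p * Y := by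
    refine (tsum_enorm_sum_rpow_le (fun k => (k : ℂ)⁻¹ ^ 2) s (fun j => a j ^ 2) hp).trans_eq ?_
    congr 1
    refine Finset.sum_congr rfl fun j _ => ?_
    rw [enorm_pow, hsq, ← ENNReal.rpow_natCast, ← ENNReal.rpow_natCast, ← ENNReal.rpow_mul,
      ← ENNReal.rpow_mul, mul_comm]
  have hT3 : ∑' m, ‖2 * ((if m ∈ s then a m else 0) *
      ∑ j ∈ s, a j * ((m - j : ℤ) : ℂ)⁻¹ ^ 2)‖ₑ ^ p ≤ 2 ^ p * ((1 + κ ^ (2 * p)) * Y) := by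
    simp only [enorm_mul (2:ℂ), ENNReal.mul_rpow_of_nonneg _ _ hp0.le, ENNReal.tsum_mul_left]
    rw [show ‖(2:ℂ)‖ₑ = 2 by simp [← ofReal_norm]]
    gcongr
    calc _ ≤ ∑' m, (‖(if m ∈ s then a m else 0)‖ₑ ^ (2 * p) +
          ‖∑ j ∈ s, a j * ((m - j : ℤ) : ℂ)⁻¹ ^ 2‖ₑ ^ (2 * p)) := by
          refine ENNReal.tsum_le_tsum fun m => ?_
          rw [enorm_mul, ENNReal.mul_rpow_of_nonneg _ _ hp0.le, hsq, hsq, add_comm]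
          simpa using ENNReal.mul_le_mul_sq_add _ _ one_ne_zero ENNReal.one_ne_top
      _ ≤ _ := by
          rw [ENNReal.tsum_add, add_mul, one_mul]
          gcongr
          · rw [tsum_eq_sum (s := s)]
            · exact Finset.sum_le_sum fun j hj => by simp [hj]
            · intro j hj
              simp [hj, hp0]
          · exact tsum_enorm_sum_rpow_le (fun k => (k : ℂ)⁻¹ ^ 2) s a (by linarith)
  have hmain : X ≤ 2⁻¹ * X + D * Y := by
    calc X ≤ ∑' m, K * (‖2 * discreteHilbert s (fun j => a j * H j) m‖ₑ ^ p +
          ‖∑ j ∈ s, a j ^ 2 * ((m - j : ℤ) : ℂ)⁻¹ ^ 2‖ₑ ^ p +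
          ‖2 * ((if m ∈ s then a m else 0) *
            ∑ j ∈ s, a j * ((m - j : ℤ) : ℂ)⁻¹ ^ 2)‖ₑ ^ p) := by
          refine ENNReal.tsum_le_tsum fun m => ?_
          rw [ENNReal.rpow_mul, ENNReal.rpow_ofNat, ← enorm_pow, hH, discreteHilbert_sq]
          refine (ENNReal.rpow_le_rpow ?_ hp0.le).trans (ENNReal.add_add_rpow_le _ _ _ hp)
          exact (enorm_add_le _ _).trans (add_le_add_left (enorm_add_le _ _) _)
      _ ≤ K * (2 ^ p * (C * (ε * X + ε⁻¹ * Y)) + κ ^ p * Y +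
          2 ^ p * ((1 + κ ^ (2 * p)) * Y)) := by
          rw [ENNReal.tsum_mul_left, ENNReal.tsum_add, ENNReal.tsum_add]
          gcongr
      _ = L * ε * X + D * Y := by
          rw [hD, hL]; ring
      _ ≤ _ := by gcongr
  have hhalf : 2⁻¹ * X ≤ D * Y := by
    have hx : X = 2⁻¹ * X + 2⁻¹ * X := by
      rw [← add_mul, ENNReal.inv_two_add_inv_two, one_mul]
    nth_rw 1 [hx] at hmain
    exact (ENNReal.add_le_add_iff_left (ENNReal.mul_ne_top (by simp) hXt)).mp hmain
  calc X = 2 * (2⁻¹ * X) := by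
        rw [← mul_assoc, ENNReal.mul_inv_cancel (by simp) (by simp), one_mul]
    _ ≤ 2 * (D * Y) := by gcongr
    _ = _ := by ring

theorem hilbertBound_two_pow (k : ℕ) : HilbertBound (2 ^ (k + 1)) := by
  induction k with
  | zero => simpa using hilbertBound_two
  | succ k ih =>
    rw [pow_succ']
    exact ih.two_mul (one_le_pow₀ one_le_two)

theorem setLIntegral_ite_lt_rpow {r t : ℝ} (hr : -1 < r) (ht : 0 ≤ t) :
    ∫⁻ x in Ioi (0:ℝ), (if x < t then ENNReal.ofReal (x ^ r) else 0) =
      ENNReal.ofReal (t ^ (r + 1) / (r + 1)) := by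
  have h1 : ∀ x : ℝ, (if x < t then ENNReal.ofReal (x ^ r) else 0) =
      (Iio t).indicator (fun x => ENNReal.ofReal (x ^ r)) x := fun x => by
    simp [indicator_apply]
  simp only [h1]
  rw [lintegral_indicator measurableSet_Iio, Measure.restrict_restrict measurableSet_Iio,
    inter_comm, Ioi_inter_Iio, restrict_Ioo_eq_restrict_Ioc,
    ← ofReal_integral_eq_lintegral_ofReal, ← intervalIntegral.integral_of_le ht,
    integral_rpow (Or.inl hr)]
  · rw [Real.zero_rpow (by linarith), sub_zero]
  · exact (intervalIntegrable_iff_integrableOn_Ioc_of_le ht).mp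
      (intervalIntegral.intervalIntegrable_rpow' hr)
  · exact (ae_restrict_iff' measurableSet_Ioc).mpr
      (ae_of_all _ fun x hx => Real.rpow_nonneg hx.1.le _)

theorem setLIntegral_ite_not_lt_rpow {r t : ℝ} (hr : r < -1) (ht : 0 < t) :
    ∫⁻ x in Ioi (0:ℝ), (if ¬ x < t then ENNReal.ofReal (x ^ r) else 0) =
      ENNReal.ofReal (-t ^ (r + 1) / (r + 1)) := by
  have h1 : ∀ x : ℝ, (if ¬ x < t then ENNReal.ofReal (x ^ r) else 0) =
      (Ici t).indicator (fun x => ENNReal.ofReal (x ^ r)) x := fun x => by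
    simp only [indicator_apply, mem_Ici, not_lt]
  simp only [h1]
  rw [lintegral_indicator measurableSet_Ici, Measure.restrict_restrict measurableSet_Ici,
    inter_eq_left.mpr (show Ici t ⊆ Ioi 0 from Ici_subset_Ioi.mpr ht),
    ← Measure.restrict_congr_set Ioi_ae_eq_Ici,
    ← ofReal_integral_eq_lintegral_ofReal, integral_Ioi_rpow_of_lt hr ht]
  · exact integrableOn_Ioi_rpow_of_lt hr ht
  · exact (ae_restrict_iff' measurableSet_Ioi).mpr
      (ae_of_all _ fun x hx => Real.rpow_nonneg (ht.trans hx).le _)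

theorem ite_le_of_enorm_add {u v : ℂ} {l q : ℝ} (hl : 0 < l) (hq : 0 < q) (hn : l < ‖u + v‖ / 2) :
    1 ≤ ENNReal.ofReal (l ^ (-2 : ℝ)) * ‖u‖ₑ ^ (2:ℝ) + ENNReal.ofReal (l ^ (-q)) * ‖v‖ₑ ^ q := by
  have key : ∀ (w : ℂ) (r : ℝ), 0 < r → l < ‖w‖ →
      1 ≤ ENNReal.ofReal (l ^ (-r)) * ‖w‖ₑ ^ r := by
    intro w r hr hw
    rw [← ofReal_norm, ENNReal.ofReal_rpow_of_nonneg (norm_nonneg _) hr.le,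
      ← ENNReal.ofReal_mul (by positivity), ENNReal.one_le_ofReal, Real.rpow_neg hl.le,
      ← div_eq_inv_mul, one_le_div (by positivity)]
    exact Real.rpow_le_rpow hl.le hw.le hr.le
  have h3 := norm_add_le u v
  rcases lt_or_ge l ‖u‖ with h | h
  · exact le_add_right (key u 2 two_pos h)
  · exact le_add_left (key v q hq (by linarith))

/-- Real interpolation between `ℓ²` and `ℓ^q`. -/
theorem HilbertBound.interpolate {p q : ℝ} (hp : 2 < p) (hpq : p < q) (h2 : HilbertBound 2)
    (hq : HilbertBound q) : HilbertBound p := by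
  obtain ⟨C, hC, hb⟩ := h2
  obtain ⟨C', hC', hb'⟩ := hq
  have hp0 : 0 < p := by linarith
  have hq0 : 0 < q := by linarith
  set c : ℝ≥0∞ := ENNReal.ofReal ((2 ^ p * p)⁻¹) with hc
  have hc0 : c ≠ 0 := by
    rw [hc, Ne, ENNReal.ofReal_eq_zero, not_le]; positivity
  set D : ℝ≥0∞ := C * ENNReal.ofReal (p - 2)⁻¹ + C' * ENNReal.ofReal (q - p)⁻¹ with hD
  refine ⟨c⁻¹ * D, ?_, fun s a => ?_⟩
  · have := ENNReal.inv_ne_top.mpr hc0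
    finiteness
  suffices c * ∑' m, ‖discreteHilbert s a m‖ₑ ^ p ≤ D * ∑ j ∈ s, ‖a j‖ₑ ^ p by
    rw [← one_mul (∑' m, ‖discreteHilbert s a m‖ₑ ^ p),
      ← ENNReal.inv_mul_cancel hc0 ENNReal.ofReal_ne_top, mul_assoc, mul_assoc]
    gcongr
  have hlayer : ∀ m, c * ‖discreteHilbert s a m‖ₑ ^ p = ∫⁻ l in Ioi (0:ℝ),
      (if l < ‖discreteHilbert s a m‖ / 2 then ENNReal.ofReal (l ^ (p - 1)) else 0) := by
    intro m
    rw [setLIntegral_ite_lt_rpow (by linarith) (by positivity), hc, ← ofReal_norm,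
      ENNReal.ofReal_rpow_of_nonneg (norm_nonneg _) hp0.le, ← ENNReal.ofReal_mul (by positivity),
      sub_add_cancel, Real.div_rpow (norm_nonneg _) (by norm_num)]
    congr 1
    field_simp
  have hpt : ∀ l ∈ Ioi (0:ℝ), ∑' m,
      (if l < ‖discreteHilbert s a m‖ / 2 then ENNReal.ofReal (l ^ (p - 1)) else 0) ≤
      ∑ j ∈ s, (C * ‖a j‖ₑ ^ (2:ℝ) * (if l < ‖a j‖ then ENNReal.ofReal (l ^ (p - 3)) else 0) +
        C' * ‖a j‖ₑ ^ q * (if ¬ l < ‖a j‖ then ENNReal.ofReal (l ^ (p - 1 - q)) else 0)) := by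
    intro l hl
    have hl0 : 0 < l := hl
    set s₁ := s.filter fun j => l < ‖a j‖
    set s₀ := s.filter fun j => ¬ l < ‖a j‖
    have e2 : ENNReal.ofReal (l ^ (p - 1)) * ENNReal.ofReal (l ^ (-2:ℝ)) =
        ENNReal.ofReal (l ^ (p - 3)) := by
      rw [← ENNReal.ofReal_mul (by positivity), ← Real.rpow_add hl0]
      ring_nf
    have eq : ENNReal.ofReal (l ^ (p - 1)) * ENNReal.ofReal (l ^ (-q)) =
        ENNReal.ofReal (l ^ (p - 1 - q)) := by
      rw [← ENNReal.ofReal_mul (by positivity), ← Real.rpow_add hl0]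
      ring_nf
    calc _ ≤ ∑' m, (ENNReal.ofReal (l ^ (p - 3)) * ‖discreteHilbert s₁ a m‖ₑ ^ (2:ℝ) +
          ENNReal.ofReal (l ^ (p - 1 - q)) * ‖discreteHilbert s₀ a m‖ₑ ^ q) := by
          refine ENNReal.tsum_le_tsum fun m => ?_
          split_ifs with h
          · have hs : discreteHilbert s a m = discreteHilbert s₁ a m + discreteHilbert s₀ a m :=
              (Finset.sum_filter_add_sum_filter_not s _ _).symm
            rw [hs] at h
            have := mul_le_mul_right (ite_le_of_enorm_add hl0 hq0 h)
              (ENNReal.ofReal (l ^ (p - 1)))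
            rwa [mul_one, mul_add, ← mul_assoc, ← mul_assoc, e2, eq] at this
          · exact zero_le
      _ ≤ ENNReal.ofReal (l ^ (p - 3)) * (C * ∑ j ∈ s₁, ‖a j‖ₑ ^ (2:ℝ)) +
          ENNReal.ofReal (l ^ (p - 1 - q)) * (C' * ∑ j ∈ s₀, ‖a j‖ₑ ^ q) := by
          rw [ENNReal.tsum_add, ENNReal.tsum_mul_left, ENNReal.tsum_mul_left]
          gcongr
          · exact hb s₁ a
          · exact hb' s₀ a
      _ = _ := by
          rw [Finset.sum_add_distrib, Finset.sum_filter, Finset.sum_filter]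
          simp only [Finset.mul_sum]
          congr 1 <;> refine Finset.sum_congr rfl fun j _ => ?_ <;> split_ifs <;> ring
  have hm : ∀ (P : ℝ → Prop) (r : ℝ), MeasurableSet {l | P l} → ∀ [DecidablePred P],
      Measurable fun l : ℝ => if P l then ENNReal.ofReal (l ^ r) else 0 := fun P r hP _ =>
    Measurable.ite hP (by fun_prop) measurable_const
  calc c * ∑' m, ‖discreteHilbert s a m‖ₑ ^ p
      = ∫⁻ l in Ioi (0:ℝ), ∑' m,
        (if l < ‖discreteHilbert s a m‖ / 2 then ENNReal.ofReal (l ^ (p - 1)) else 0) := by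
        rw [lintegral_tsum fun m => (hm _ _ measurableSet_Iio).aemeasurable,
          ← ENNReal.tsum_mul_left]
        exact tsum_congr hlayer
    _ ≤ _ := setLIntegral_mono' measurableSet_Ioi hpt
    _ ≤ ∑ j ∈ s, D * ‖a j‖ₑ ^ p := by
        have m1 : ∀ j, Measurable fun l : ℝ =>
            if l < ‖a j‖ then ENNReal.ofReal (l ^ (p - 3)) else 0 :=
          fun j => hm _ _ measurableSet_Iio
        have m2 : ∀ j, Measurable fun l : ℝ =>
            if ¬ l < ‖a j‖ then ENNReal.ofReal (l ^ (p - 1 - q)) else 0 :=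
          fun j => hm _ _ measurableSet_Iio.compl
        rw [lintegral_finsetSum _ fun j _ => by
          exact ((m1 j).const_mul _).add ((m2 j).const_mul _)]
        refine Finset.sum_le_sum fun j _ => ?_
        rw [lintegral_add_left ((m1 j).const_mul _), lintegral_const_mul _ (m1 j),
          lintegral_const_mul _ (m2 j)]
        rcases (norm_nonneg (a j)).eq_or_lt with h0 | h0
        · have : a j = 0 := norm_eq_zero.mp h0.symm
          simp [this, hq0]
        rw [setLIntegral_ite_lt_rpow (by linarith) h0.le,
          setLIntegral_ite_not_lt_rpow (by linarith) h0, hD, add_mul, ← ofReal_norm]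
        have e : ∀ r : ℝ, ENNReal.ofReal ‖a j‖ ^ r = ENNReal.ofReal (‖a j‖ ^ r) :=
          fun r => ENNReal.ofReal_rpow_of_pos h0
        simp only [e, mul_assoc]
        rw [← ENNReal.ofReal_mul (by positivity), ← ENNReal.ofReal_mul (by positivity),
          ← ENNReal.ofReal_mul (by simp; linarith), ← ENNReal.ofReal_mul (by simp; linarith)]
        refine le_of_eq ?_
        congr 3
        · rw [show p - 3 + 1 = p - 2 by ring, ← mul_div_assoc, ← Real.rpow_add h0,
            add_sub_cancel, div_eq_inv_mul]
        · rw [show p - 1 - q + 1 = -(q - p) by ring, neg_div_neg_eq, ← mul_div_assoc,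
            ← Real.rpow_add h0, div_eq_inv_mul]
          ring_nf
    _ = _ := by rw [Finset.mul_sum]

theorem hilbertBound {p : ℝ} (hp : 2 ≤ p) : HilbertBound p := by
  rcases hp.eq_or_lt with rfl | hp
  · exact hilbertBound_two
  obtain ⟨k, hk⟩ := pow_unbounded_of_one_lt p one_lt_two
  exact hilbertBound_two.interpolate hp
    (hk.trans (pow_lt_pow_right₀ one_lt_two k.lt_succ_self)) (hilbertBound_two_pow k)

/-- The inverse Fourier transform of the indicator function of `[0, 1]`, reflected. -/
noncomputable def unitKernel (t : ℝ) : ℂ :=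
  ∫ ξ in (0:ℝ)..1, Complex.exp (((-2 * π * t * ξ : ℝ) : ℂ) * Complex.I)

theorem continuous_unitKernel : Continuous unitKernel :=
  intervalIntegral.continuous_parametric_intervalIntegral_of_continuous' (by fun_prop) 0 1

theorem norm_unitKernel_le_one (t : ℝ) : ‖unitKernel t‖ ≤ 1 := by
  refine (intervalIntegral.norm_integral_le_of_norm_le_const fun ξ _ => ?_).trans_eq
    (by norm_num : (1:ℝ) * |1 - 0| = 1)
  rw [Complex.norm_exp_ofReal_mul_I]

/-- The coefficient in the asymptotic behaviour of `unitKernel` along `y + ℤ`. -/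
noncomputable def unitKernelCoeff (y : ℝ) : ℂ :=
  (1 - Complex.exp (((-2 * π * y : ℝ) : ℂ) * Complex.I)) / (2 * π * Complex.I)

theorem norm_unitKernelCoeff_le_one (y : ℝ) : ‖unitKernelCoeff y‖ ≤ 1 := by
  rw [unitKernelCoeff, norm_div]
  have h1 : ‖1 - Complex.exp (((-2 * π * y : ℝ) : ℂ) * Complex.I)‖ ≤ 2 := by
    refine (norm_sub_le _ _).trans ?_
    rw [Complex.norm_exp_ofReal_mul_I]; norm_num
  have h2 : ‖(2 * π * Complex.I : ℂ)‖ = 2 * π := by simp [abs_of_pos pi_pos]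
  rw [h2, div_le_one (by positivity)]
  linarith [pi_gt_three]

theorem mul_unitKernel_add_int (y : ℝ) (k : ℤ) :
    ((y + k : ℝ) : ℂ) * unitKernel (y + k) = unitKernelCoeff y := by
  have hpi : (2 * π * Complex.I : ℂ) ≠ 0 := by simp [pi_ne_zero]
  rw [unitKernelCoeff, eq_div_iff hpi]
  have hexp : Complex.exp (((-2 * π * y : ℝ) : ℂ) * Complex.I) =
      Complex.exp (((-2 * π * (y + k) : ℝ) : ℂ) * Complex.I) := by
    rw [Complex.exp_eq_exp_iff_exists_int]
    exact ⟨k, by push_cast; ring⟩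
  rw [hexp]
  rcases eq_or_ne (y + k) 0 with h | h
  · simp [h]
  have hc : (((-2 * π * (y + k) : ℝ) : ℂ) * Complex.I) ≠ 0 := by
    simp only [ne_eq, mul_eq_zero, Complex.ofReal_eq_zero, Complex.I_ne_zero, or_false]
    simp [pi_ne_zero, h]
  have h1 := integral_exp_mul_complex (a := 0) (b := 1) hc
  have h2 : unitKernel (y + k) = ∫ x in (0:ℝ)..1,
      Complex.exp ((((-2 * π * (y + k) : ℝ) : ℂ) * Complex.I) * x) := by
    rw [unitKernel]
    congr 1; ext x; congr 1; push_cast; ring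
  rw [h2, h1]
  rw [mul_div_assoc', div_mul_eq_mul_div, div_eq_iff hc]
  simp only [Complex.ofReal_one, mul_one, Complex.ofReal_zero, mul_zero, Complex.exp_zero]
  push_cast
  ring

theorem norm_unitKernel_sub_le {y : ℝ} (hy : y ∈ Icc (0:ℝ) 1) (k : ℤ) :
    ‖unitKernel (y + k) - unitKernelCoeff y * (k : ℂ)⁻¹‖ ≤ 4 / (1 + (k:ℝ) ^ 2) := by
  rcases eq_or_ne k 0 with rfl | h0
  · simp only [Int.cast_zero, inv_zero, mul_zero, sub_zero, add_zero]
    refine (norm_unitKernel_le_one _).trans (by norm_num)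
  rcases eq_or_ne k (-1) with rfl | h1
  · refine (norm_sub_le _ _).trans ?_
    have := norm_unitKernel_le_one (y + ((-1 : ℤ) : ℝ))
    have := norm_unitKernelCoeff_le_one y
    simp only [norm_mul, norm_inv, Int.cast_neg, Int.cast_one, norm_neg, norm_one, inv_one, mul_one]
      at *
    linarith
  have hk : (1:ℝ) ≤ |(k:ℝ)| := by exact_mod_cast Int.one_le_abs h0
  have hyk : |(k:ℝ)| / 2 ≤ |y + k| := by
    rcases lt_or_gt_of_ne h0 with h | h
    · have : (k:ℝ) ≤ -2 := by exact_mod_cast (show k ≤ -2 by omega)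
      rw [abs_of_nonpos (by linarith), abs_of_nonpos (by linarith [hy.2])]
      linarith [hy.2]
    · have : (1:ℝ) ≤ k := by exact_mod_cast h
      rw [abs_of_nonneg (by linarith), abs_of_nonneg (by linarith [hy.1])]
      linarith [hy.1]
  have hyk0 : y + k ≠ 0 := fun h => by rw [h, abs_zero] at hyk; linarith
  have hkc : (k : ℂ) ≠ 0 := by exact_mod_cast h0
  have hykc : ((y + k : ℝ) : ℂ) ≠ 0 := by exact_mod_cast hyk0
  have hD : unitKernel (y + k) = unitKernelCoeff y / ((y + k : ℝ) : ℂ) := by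
    rw [eq_div_iff hykc, mul_comm, mul_unitKernel_add_int]
  have e : unitKernel (y + k) - unitKernelCoeff y * (k : ℂ)⁻¹ =
      unitKernelCoeff y * (-(y:ℂ)) / (((y + k : ℝ) : ℂ) * (k : ℂ)) := by
    rw [hD]; field_simp; push_cast; ring
  rw [e, norm_div, norm_mul, norm_mul, norm_neg, Complex.norm_real, Complex.norm_real,
    Complex.norm_intCast, Real.norm_eq_abs, Real.norm_eq_abs]
  have hnum : ‖unitKernelCoeff y‖ * |y| ≤ 1 :=
    mul_le_one₀ (norm_unitKernelCoeff_le_one y) (abs_nonneg _) (abs_le.2 ⟨by linarith [hy.1], hy.2⟩)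
  have hsq : (k:ℝ) ^ 2 = |(k:ℝ)| ^ 2 := (sq_abs _).symm
  have hpos : 0 < |y + k| * |(k:ℝ)| := by positivity
  rw [hsq, div_le_div_iff₀ hpos (by positivity)]
  have : |(k:ℝ)| / 2 * |(k:ℝ)| ≤ |y + k| * |(k:ℝ)| := by gcongr
  have : ‖unitKernelCoeff y‖ * |y| * (1 + |(k:ℝ)| ^ 2) ≤ 1 * (1 + |(k:ℝ)| ^ 2) := by gcongr
  nlinarith

theorem summable_four_div_one_add_sq : Summable fun k : ℤ => 4 / (1 + (k:ℝ) ^ 2) := by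
  have h := (Real.summable_one_div_int_pow (p := 2)).mpr one_lt_two
  refine Summable.of_norm_bounded_eventually (h.mul_left 4) ?_
  filter_upwards [(finite_singleton (0:ℤ)).compl_mem_cofinite] with k hk
  have hk : k ≠ 0 := by simpa using hk
  have : (k:ℝ) ≠ 0 := by exact_mod_cast hk
  have : 0 < (k:ℝ) ^ 2 := by positivity
  rw [Real.norm_of_nonneg (by positivity), mul_one_div]
  gcongr
  linarith

/-- Discrete bound for the kernel sampled along a translate of the integers. -/
theorem exists_tsum_sum_unitKernel_le {p : ℝ} (hp : 2 ≤ p) :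
    ∃ C : ℝ≥0∞, C ≠ ∞ ∧ ∀ y ∈ Icc (0:ℝ) 1, ∀ (s : Finset ℤ) (b : ℤ → ℂ),
      ∑' m : ℤ, ‖∑ j ∈ s, b j * unitKernel (y + ((j - m : ℤ) : ℝ))‖ₑ ^ p ≤
        C * ∑ j ∈ s, ‖b j‖ₑ ^ p := by
  obtain ⟨H, hH, hb⟩ := hilbertBound hp
  have hp1 : 1 ≤ p := by linarith
  set S : ℝ≥0∞ := ENNReal.ofReal (∑' k : ℤ, 4 / (1 + (k:ℝ) ^ 2)) with hS
  refine ⟨2 ^ (p - 1) * (H + S ^ p), ?_, fun y hy s b => ?_⟩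
  · refine ENNReal.mul_ne_top (ENNReal.rpow_ne_top_of_nonneg (by linarith) (by simp)) ?_
    exact ENNReal.add_ne_top.2
      ⟨hH, ENNReal.rpow_ne_top_of_nonneg (by linarith) ENNReal.ofReal_ne_top⟩
  set E : ℤ → ℂ := fun k => unitKernel (y + ((-k : ℤ) : ℝ)) - unitKernelCoeff y * ((-k : ℤ) : ℂ)⁻¹
    with hE
  have hES : ∑' k, ‖E k‖ₑ ≤ S := by
    rw [hS, ENNReal.ofReal_tsum_of_nonneg (fun k => by positivity) summable_four_div_one_add_sq]
    refine ENNReal.tsum_le_tsum fun k => ?_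
    rw [← ofReal_norm]
    refine ENNReal.ofReal_le_ofReal ?_
    have := norm_unitKernel_sub_le hy (-k)
    simpa [hE] using this
  have hdec : ∀ m, ∑ j ∈ s, b j * unitKernel (y + ((j - m : ℤ) : ℝ)) =
      -unitKernelCoeff y * discreteHilbert s b m + ∑ j ∈ s, b j * E (m - j) := by
    intro m
    rw [discreteHilbert, Finset.mul_sum, ← Finset.sum_add_distrib]
    refine Finset.sum_congr rfl fun j _ => ?_
    simp only [hE, neg_sub]
    rw [← neg_sub m j, Int.cast_neg (R := ℂ), inv_neg]
    ring
  have hc : ‖-unitKernelCoeff y‖ₑ ≤ 1 := by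
    rw [enorm_neg, ← ofReal_norm]
    exact ENNReal.ofReal_le_one.2 (norm_unitKernelCoeff_le_one y)
  calc ∑' m : ℤ, ‖∑ j ∈ s, b j * unitKernel (y + ((j - m : ℤ) : ℝ))‖ₑ ^ p
      ≤ ∑' m : ℤ, 2 ^ (p - 1) * (‖discreteHilbert s b m‖ₑ ^ p +
          ‖∑ j ∈ s, b j * E (m - j)‖ₑ ^ p) := by
        refine ENNReal.tsum_le_tsum fun m => ?_
        rw [hdec]
        refine le_trans ?_ (ENNReal.rpow_add_le_mul_rpow_add_rpow _ _ hp1)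
        gcongr
        refine (enorm_add_le _ _).trans ?_
        gcongr
        rw [enorm_mul]
        exact mul_le_of_le_one_left' hc
    _ = 2 ^ (p - 1) * (∑' m : ℤ, ‖discreteHilbert s b m‖ₑ ^ p +
          ∑' m : ℤ, ‖∑ j ∈ s, b j * E (m - j)‖ₑ ^ p) := by
        rw [ENNReal.tsum_mul_left, ENNReal.tsum_add]
    _ ≤ 2 ^ (p - 1) * (H * ∑ j ∈ s, ‖b j‖ₑ ^ p + S ^ p * ∑ j ∈ s, ‖b j‖ₑ ^ p) := by
        gcongr
        · exact hb s b
        · exact (tsum_enorm_sum_rpow_le E s b hp1).trans (by gcongr)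
    _ = _ := by rw [← add_mul, mul_assoc]

theorem tsum_enorm_tsum_unitKernel_le {p : ℝ} {C : ℝ≥0∞} {y : ℝ}
    (hC : ∀ (s : Finset ℤ) (b : ℤ → ℂ),
      ∑' m : ℤ, ‖∑ j ∈ s, b j * unitKernel (y + ((j - m : ℤ) : ℝ))‖ₑ ^ p ≤
        C * ∑ j ∈ s, ‖b j‖ₑ ^ p) {b : ℤ → ℂ} (hb : Summable fun j => ‖b j‖) :
    ∑' m : ℤ, ‖∑' j, b j * unitKernel (y + ((j - m : ℤ) : ℝ))‖ₑ ^ p ≤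
        C * ∑' j, ‖b j‖ₑ ^ p := by
  rw [ENNReal.tsum_eq_iSup_sum]
  refine iSup_le fun M => ?_
  have hs : ∀ m : ℤ, Summable fun j => b j * unitKernel (y + ((j - m : ℤ) : ℝ)) := fun m =>
    Summable.of_norm_bounded hb fun j => by
      rw [norm_mul]
      exact mul_le_of_le_one_right (norm_nonneg _) (norm_unitKernel_le_one _)
  have ht : Filter.Tendsto (fun s : Finset ℤ => ∑ m ∈ M,
      ‖∑ j ∈ s, b j * unitKernel (y + ((j - m : ℤ) : ℝ))‖ₑ ^ p) Filter.atTop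
      (nhds (∑ m ∈ M, ‖∑' j, b j * unitKernel (y + ((j - m : ℤ) : ℝ))‖ₑ ^ p)) :=
    tendsto_finsetSum _ fun m _ =>
      (ENNReal.continuous_rpow_const.tendsto _).comp (hs m).hasSum.enorm
  refine le_of_tendsto' ht fun s => ?_
  refine (ENNReal.sum_le_tsum M).trans ((hC s b).trans ?_)
  gcongr
  exact ENNReal.sum_le_tsum s

theorem exp_mul_FT (f : ℝ → ℂ) (x ξ : ℝ) :
    Complex.exp (((2 * π * x * ξ : ℝ) : ℂ) * Complex.I) * FT f ξ =
      ∫ t : ℝ, Complex.exp (((-2 * π * t * ξ : ℝ) : ℂ) * Complex.I) * f (x + t) := by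
  rw [FT, ← integral_const_mul, ← integral_add_left_eq_self _ x]
  refine integral_congr_ae (ae_of_all _ fun t => ?_)
  simp only
  rw [← mul_assoc, ← Complex.exp_add]
  congr 2
  push_cast; ring

theorem linMul_Icc_eq_fourier {f : ℝ → ℂ} (hf : Integrable f) (n : ℤ) (x : ℝ) :
    linMul (Icc (n : ℝ) (n + 1)) f x =
      FourierTransform.fourier (fun t => f (x + t) * unitKernel t) (n : ℝ) := by
  have h1 : linMul (Icc (n : ℝ) (n + 1)) f x =
      ∫ ξ in (0:ℝ)..1, ∫ t : ℝ, Complex.exp (((-2 * π * t * (ξ + n) : ℝ) : ℂ) * Complex.I) *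
        f (x + t) := by
    rw [linMul]
    have : ∀ ξ : ℝ, Complex.exp (((2 * π * x * ξ : ℝ) : ℂ) * Complex.I) * FT f ξ *
        (Icc (n : ℝ) (n + 1)).indicator 1 ξ = (Icc (n : ℝ) (n + 1)).indicator (fun ξ =>
          ∫ t : ℝ, Complex.exp (((-2 * π * t * ξ : ℝ) : ℂ) * Complex.I) * f (x + t)) ξ := by
      intro ξ
      by_cases h : ξ ∈ Icc (n : ℝ) (n + 1)
      · simp only [indicator_of_mem h, Pi.one_apply, mul_one, exp_mul_FT]
      · simp only [indicator_of_notMem h, mul_zero]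
    simp only [this]
    rw [integral_indicator measurableSet_Icc, integral_Icc_eq_integral_Ioc,
      ← intervalIntegral.integral_of_le (by linarith),
      intervalIntegral.integral_comp_add_right (fun ξ => ∫ t : ℝ,
        Complex.exp (((-2 * π * t * ξ : ℝ) : ℂ) * Complex.I) * f (x + t)) (n : ℝ)]
    simp [add_comm]
  have hint : Integrable (Function.uncurry fun ξ t : ℝ =>
      Complex.exp (((-2 * π * t * (ξ + n) : ℝ) : ℂ) * Complex.I) * f (x + t))
      ((volume.restrict (Ioc (0:ℝ) 1)).prod volume) := by
    have hg : Integrable (fun z : ℝ × ℝ => f (x + z.2))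
        ((volume.restrict (Ioc (0:ℝ) 1)).prod volume) := (hf.comp_add_left x).comp_snd _
    refine hg.bdd_mul (c := 1) (Continuous.aestronglyMeasurable (by fun_prop))
      (ae_of_all _ fun z => ?_)
    rw [Complex.norm_exp_ofReal_mul_I]
  rw [h1, intervalIntegral.integral_of_le zero_le_one, integral_integral_swap hint,
    Real.fourier_real_eq_integral_exp_smul]
  refine integral_congr_ae (ae_of_all _ fun t => ?_)
  simp only [smul_eq_mul]
  rw [unitKernel, ← intervalIntegral.integral_of_le zero_le_one,
    ← intervalIntegral.integral_const_mul, ← intervalIntegral.integral_const_mul]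
  refine intervalIntegral.integral_congr fun ξ _ => ?_
  rw [show ((-2 * π * t * (ξ + n) : ℝ) : ℂ) * Complex.I =
    ((-2 * π * t * n : ℝ) : ℂ) * Complex.I + ((-2 * π * t * ξ : ℝ) : ℂ) * Complex.I by
      push_cast; ring, Complex.exp_add]
  ring

/-- Parseval's identity for the periodization of a function with quadratic decay. -/
theorem hasSum_norm_fourier_sq (h : C(ℝ, ℂ))
    (hO : h =O[Filter.cocompact ℝ] fun x => |x| ^ (-2 : ℝ)) :
    (Continuous fun y : ℝ => ∑' k : ℤ, h (y + k)) ∧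
      HasSum (fun n : ℤ => ‖FourierTransform.fourier (h : ℝ → ℂ) (n : ℝ)‖ ^ 2)
        (∫ y in (0:ℝ)..1, ‖∑' k : ℤ, h (y + k)‖ ^ 2) := by
  have hs : ∀ K : TopologicalSpace.Compacts ℝ,
      Summable fun n : ℤ => ‖(h.comp (ContinuousMap.addRight (n : ℝ))).restrict K‖ := fun K =>
    summable_of_isBigO (Real.summable_abs_int_rpow one_lt_two)
      ((isBigO_norm_restrict_cocompact h two_pos hO K).comp_tendsto Int.tendsto_coe_cofinite)
  have hP : ∀ y : ℝ, (∑' k : ℤ, h.comp (ContinuousMap.addRight (k : ℝ))) y =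
      ∑' k : ℤ, h (y + k) := by
    intro y
    rw [← ContinuousMap.tsum_apply (ContinuousMap.summable_of_locally_summable_norm hs)]
    simp
  have hcont : Continuous fun y : ℝ => ∑' k : ℤ, h (y + k) := by
    simp only [← hP]; exact ContinuousMap.continuous _
  refine ⟨hcont, ?_⟩
  have h1 := hasSum_sq_fourierCoeffOn (one_pos : (0:ℝ) < 1) hcont.memLp_two_Ioc
  simp only [sub_zero, inv_one, one_smul] at h1
  convert h1 using 4 with n
  rw [← Real.fourierCoeff_tsum_comp_add hs, fourierCoeff_eq_intervalIntegral _ n 0,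
    fourierCoeffOn_eq_integral]
  simp only [Function.Periodic.lift_coe, zsmul_one, hP, sub_zero, zero_add]
  simp only [fourier_coe_apply, sub_zero]

theorem isBigO_schwartz_mul_unitKernel (f : SchwartzMap ℝ ℂ) (x : ℝ) :
    (fun t => f (x + t) * unitKernel t) =O[Filter.cocompact ℝ] fun t => |t| ^ (-2 : ℝ) := by
  have h1 := (SchwartzMap.compSubConstCLM ℂ (-x) f).isBigO_cocompact_rpow (-2)
  refine (Asymptotics.isBigO_of_le _ fun t => ?_).trans h1
  rw [norm_mul]
  refine (mul_le_of_le_one_right (norm_nonneg _) (norm_unitKernel_le_one _)).trans_eq ?_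
  simp [add_comm]

/-- Parseval's identity for the square function at a point. -/
theorem hasSum_norm_linMul_sq (f : SchwartzMap ℝ ℂ) (x : ℝ) :
    (Continuous fun y : ℝ => ∑' k : ℤ, f (x + (y + k)) * unitKernel (y + k)) ∧
      HasSum (fun n : ℤ => ‖linMul (Icc (n : ℝ) (n + 1)) f x‖ ^ 2)
        (∫ y in (0:ℝ)..1, ‖∑' k : ℤ, f (x + (y + k)) * unitKernel (y + k)‖ ^ 2) := by
  simp only [linMul_Icc_eq_fourier f.integrable]
  exact hasSum_norm_fourier_sq ⟨fun t => f (x + t) * unitKernel t,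
    (f.continuous.comp (by fun_prop)).mul continuous_unitKernel⟩
    (isBigO_schwartz_mul_unitKernel f x)

/-- The square function at a point is controlled by an `L^p` mean of a periodization. -/
theorem enorm_sqrt_tsum_linMul_rpow_le (f : SchwartzMap ℝ ℂ) (x : ℝ) {p : ℝ} (hp : 2 ≤ p) :
    ‖√(∑' n : ℤ, ‖linMul (Icc (n : ℝ) (n + 1)) f x‖ ^ 2)‖ₑ ^ p ≤
      ∫⁻ y in Ioc (0:ℝ) 1, ‖∑' k : ℤ, f (x + (y + k)) * unitKernel (y + k)‖ₑ ^ p := by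
  obtain ⟨hc, hs⟩ := hasSum_norm_linMul_sq f x
  set P := fun y : ℝ => ∑' k : ℤ, f (x + (y + k)) * unitKernel (y + k) with hP
  have hprob : IsProbabilityMeasure (volume.restrict (Ioc (0:ℝ) 1)) := ⟨by simp⟩
  have h0 : (0:ℝ) < p := by linarith
  have h1 := eLpNorm'_le_eLpNorm'_of_exponent_le two_pos hp (volume.restrict (Ioc (0:ℝ) 1))
    hc.aestronglyMeasurable
  have h2 : ‖√(∑' n : ℤ, ‖linMul (Icc (n : ℝ) (n + 1)) f x‖ ^ 2)‖ₑ =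
      eLpNorm' P 2 (volume.restrict (Ioc (0:ℝ) 1)) := by
    rw [hs.tsum_eq, intervalIntegral.integral_of_le zero_le_one, eLpNorm',
      Real.enorm_of_nonneg (Real.sqrt_nonneg _), Real.sqrt_eq_rpow,
      ← ENNReal.ofReal_rpow_of_nonneg (integral_nonneg fun _ => by positivity) (by norm_num),
      ofReal_integral_eq_lintegral_ofReal _ (ae_of_all _ fun _ => by positivity)]
    · congr 1
      refine lintegral_congr fun y => ?_
      rw [← ofReal_norm, ENNReal.ofReal_rpow_of_nonneg (norm_nonneg _) zero_le_two, Real.rpow_two]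
    · exact ((hc.norm.pow 2).integrableOn_Icc).mono_set Ioc_subset_Icc_self
  rw [h2]
  refine (ENNReal.rpow_le_rpow h1 h0.le).trans_eq ?_
  rw [eLpNorm', ← ENNReal.rpow_mul, one_div_mul_cancel h0.ne', ENNReal.rpow_one]

theorem lintegral_eq_tsum_setLIntegral_Ioc (G : ℝ → ℝ≥0∞) :
    ∫⁻ x, G x = ∑' m : ℤ, ∫⁻ x in Ioc (0:ℝ) 1, G (x + m) := by
  rw [← setLIntegral_univ, ← iUnion_Ioc_intCast ℝ,
    lintegral_iUnion (fun _ => measurableSet_Ioc) (pairwise_disjoint_Ioc_intCast ℝ)]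
  refine tsum_congr fun m => ?_
  have h := (measurePreserving_add_right volume (m : ℝ)).setLIntegral_comp_preimage_emb
    (measurableEmbedding_addRight (m : ℝ)) G (Ioc (m : ℝ) (m + 1))
  rw [← h]
  simp

theorem tsum_lintegral_le {α ι : Type*} [MeasurableSpace α] (μ : Measure α) (F : ι → α → ℝ≥0∞) :
    ∑' i, ∫⁻ x, F i x ∂μ ≤ ∫⁻ x, ∑' i, F i x ∂μ := by
  classical
  rw [ENNReal.tsum_eq_iSup_sum]
  refine iSup_le fun s => le_trans ?_ (lintegral_mono fun x => ENNReal.sum_le_tsum s)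
  induction s using Finset.induction_on with
  | empty => simp
  | insert i s hi ih =>
    simp only [Finset.sum_insert hi]
    exact (add_le_add_right ih _).trans (le_lintegral_add _ _)

theorem summable_norm_schwartz_add_int (f : SchwartzMap ℝ ℂ) (x : ℝ) :
    Summable fun j : ℤ => ‖f (x + j)‖ := by
  have h1 := (SchwartzMap.compSubConstCLM ℂ (-x) f).isBigO_cocompact_rpow (-2)
  refine summable_of_isBigO (Real.summable_abs_int_rpow one_lt_two)
    (((Asymptotics.isBigO_of_le _ fun t => ?_).trans h1).comp_tendsto
      (f := fun t : ℝ => ‖f (x + t)‖) Int.tendsto_coe_cofinite)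
  simp [add_comm]

theorem exists_lintegral_sqrt_tsum_linMul_le {p : ℝ} (hp : 2 ≤ p) :
    ∃ C : ℝ≥0∞, C ≠ ∞ ∧ ∀ f : SchwartzMap ℝ ℂ,
      ∫⁻ x, ‖√(∑' n : ℤ, ‖linMul (Icc (n : ℝ) (n + 1)) f x‖ ^ 2)‖ₑ ^ p ≤
        C * ∫⁻ x, ‖f x‖ₑ ^ p := by
  obtain ⟨C, hC, hb⟩ := exists_tsum_sum_unitKernel_le hp
  refine ⟨C, hC, fun f => ?_⟩
  have key : ∀ x, ∀ y ∈ Ioc (0:ℝ) 1,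
      ∑' m : ℤ, ‖∑' k : ℤ, f (x + m + (y + k)) * unitKernel (y + k)‖ₑ ^ p ≤
        C * ∑' j : ℤ, ‖f (x + (y + j))‖ₑ ^ p := by
    intro x y hy
    have h := tsum_enorm_tsum_unitKernel_le (hb y ⟨hy.1.le, hy.2⟩)
      (summable_norm_schwartz_add_int f (x + y))
    simp only [← add_assoc x y] at h ⊢
    refine le_trans (ENNReal.tsum_le_tsum fun m => ?_) h
    rw [← (Equiv.subRight m).tsum_eq]
    refine le_of_eq ?_
    congr 3
    ext j
    simp only [Equiv.subRight_apply]
    congr 2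
    push_cast; ring
  calc ∫⁻ x, ‖√(∑' n : ℤ, ‖linMul (Icc (n : ℝ) (n + 1)) f x‖ ^ 2)‖ₑ ^ p
      ≤ ∫⁻ x, ∫⁻ y in Ioc (0:ℝ) 1, ‖∑' k : ℤ, f (x + (y + k)) * unitKernel (y + k)‖ₑ ^ p :=
        lintegral_mono fun x => enorm_sqrt_tsum_linMul_rpow_le f x hp
    _ = ∑' m : ℤ, ∫⁻ x in Ioc (0:ℝ) 1, ∫⁻ y in Ioc (0:ℝ) 1,
          ‖∑' k : ℤ, f (x + m + (y + k)) * unitKernel (y + k)‖ₑ ^ p :=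
        lintegral_eq_tsum_setLIntegral_Ioc _
    _ ≤ ∫⁻ x in Ioc (0:ℝ) 1, ∑' m : ℤ, ∫⁻ y in Ioc (0:ℝ) 1,
          ‖∑' k : ℤ, f (x + m + (y + k)) * unitKernel (y + k)‖ₑ ^ p := tsum_lintegral_le _ _
    _ ≤ ∫⁻ x in Ioc (0:ℝ) 1, C * ∫⁻ x, ‖f x‖ₑ ^ p := by
        refine lintegral_mono fun x => ?_
        calc ∑' m : ℤ, ∫⁻ y in Ioc (0:ℝ) 1,
              ‖∑' k : ℤ, f (x + m + (y + k)) * unitKernel (y + k)‖ₑ ^ p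
            ≤ ∫⁻ y in Ioc (0:ℝ) 1, ∑' m : ℤ,
              ‖∑' k : ℤ, f (x + m + (y + k)) * unitKernel (y + k)‖ₑ ^ p := tsum_lintegral_le _ _
          _ ≤ ∫⁻ y in Ioc (0:ℝ) 1, C * ∑' j : ℤ, ‖f (x + (y + j))‖ₑ ^ p :=
              setLIntegral_mono' measurableSet_Ioc fun y hy => key x y hy
          _ = C * ∑' j : ℤ, ∫⁻ y in Ioc (0:ℝ) 1, ‖f (x + (y + j))‖ₑ ^ p := by
              have hm : ∀ j : ℤ, Measurable fun y : ℝ => ‖f (x + (y + j))‖ₑ ^ p := fun j =>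
                ((f.continuous.comp (by fun_prop)).enorm.measurable).pow_const p
              rw [lintegral_const_mul' _ _ hC, lintegral_tsum fun j => (hm j).aemeasurable]
          _ = C * ∫⁻ y, ‖f (x + y)‖ₑ ^ p := by
              rw [lintegral_eq_tsum_setLIntegral_Ioc fun y => ‖f (x + y)‖ₑ ^ p]
          _ = C * ∫⁻ y, ‖f y‖ₑ ^ p := by
              rw [lintegral_add_left_eq_self (fun y => ‖f y‖ₑ ^ p) x]
    _ = C * ∫⁻ x, ‖f x‖ₑ ^ p := by simp

/-- **Carleson.** For `p ∈ [2,∞)` the square function associated to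
the unit intervals `[n, n+1]`, `n ∈ ℤ`, is bounded on `L^p(ℝ)`. -/
theorem carleson_square_function (p : ℝ) (hp : 2 ≤ p) :
    ∃ c : ℝ, 0 < c ∧ ∀ f : SchwartzMap ℝ ℂ,
      eLpNorm (fun x : ℝ =>
          Real.sqrt (∑' n : ℤ, ‖linMul (Set.Icc (n : ℝ) ((n : ℝ) + 1)) (⇑f) x‖ ^ 2))
          (ENNReal.ofReal p) volume ≤
        ENNReal.ofReal c * eLpNorm (⇑f) (ENNReal.ofReal p) volume := by
  obtain ⟨C, hC, h⟩ := exists_lintegral_sqrt_tsum_linMul_le hp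
  have hp0 : 0 < p := by linarith
  have hCp : C ^ (1 / p) ≠ ∞ := ENNReal.rpow_ne_top_of_nonneg (by positivity) hC
  refine ⟨(C ^ (1 / p)).toReal + 1, by positivity, fun f => ?_⟩
  have hq : ENNReal.ofReal p ≠ 0 := by simpa using hp0
  rw [eLpNorm_eq_lintegral_rpow_enorm_toReal hq ENNReal.ofReal_ne_top,
    eLpNorm_eq_lintegral_rpow_enorm_toReal hq ENNReal.ofReal_ne_top, ENNReal.toReal_ofReal hp0.le]
  have h2 := ENNReal.rpow_le_rpow (h f) (by positivity : 0 ≤ 1 / p)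
  rw [ENNReal.mul_rpow_of_nonneg _ _ (by positivity)] at h2
  refine h2.trans (mul_le_mul_left ?_ _)
  rw [← ENNReal.ofReal_toReal hCp]
  exact ENNReal.ofReal_le_ofReal (by simp)
end

section
/- (Lacey) Let p, q ∈ [2, ∞] with 1/p + 1/q = 1/2, and let Ψ be a Schwartz function on ℝ whose Fourier transform is supported in [−1, 1]. Then there exists a constant c = c(p, q, Ψ) such that for all Schwartz functions f, g on ℝ, ‖ ( Σ_{n∈ℤ} | ∫_ℝ f(x−y) g(x+y) e^{2πi n y} Ψ(y) dy |² )^{1/2} ‖_{L^2(ℝ)} ≤ c ‖f‖_{L^p(ℝ)} ‖g‖_{L^q(ℝ)}. -/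
open MeasureTheory Real Set
open scoped ENNReal

section Periodization

open FourierTransform Filter Asymptotics TopologicalSpace

theorem summable_norm_restrict_comp_addRight {F : C(ℝ, ℂ)} {b : ℝ} (hb : 1 < b)
    (hF : F =O[cocompact ℝ] fun x : ℝ => |x| ^ (-b)) (K : Compacts ℝ) :
    Summable fun n : ℤ => ‖(F.comp (ContinuousMap.addRight (n : ℝ))).restrict K‖ :=
  summable_of_isBigO (Real.summable_abs_int_rpow hb)
    ((isBigO_norm_restrict_cocompact F (zero_lt_one.trans hb) hF K).comp_tendsto
      Int.tendsto_coe_cofinite)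

/-- Parseval's identity for the periodization of a function on the line. -/
theorem hasSum_sq_norm_fourier_int {F : C(ℝ, ℂ)}
    (hF : ∀ K : Compacts ℝ,
      Summable fun n : ℤ => ‖(F.comp (ContinuousMap.addRight (n : ℝ))).restrict K‖) :
    HasSum (fun n : ℤ => ‖𝓕 (F : ℝ → ℂ) n‖ ^ 2)
      (∫ y in (0 : ℝ)..1, ‖∑' k : ℤ, F (y + k)‖ ^ 2) := by
  let G : C(UnitAddCircle, ℂ) :=
    ⟨(F.periodic_tsum_comp_add_zsmul 1).lift, continuous_coinduced_dom.mpr (map_continuous _)⟩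
  have hG : ∀ n : ℤ, fourierCoeff G n = 𝓕 (F : ℝ → ℂ) n :=
    fun n => Real.fourierCoeff_tsum_comp_add hF n
  have h := hasSum_sq_fourierCoeff (ContinuousMap.toLp (E := ℂ) 2 AddCircle.haarAddCircle ℂ G)
  simp_rw [fourierCoeff_toLp, hG] at h
  convert h using 1
  have hGy : ∀ y : ℝ, ∑' k : ℤ, F (y + k) = G (y : UnitAddCircle) := fun y => by
    change _ = (F.periodic_tsum_comp_add_zsmul 1).lift (y : UnitAddCircle)
    rw [Function.Periodic.lift_coe,
      ← ContinuousMap.tsum_apply (ContinuousMap.summable_of_locally_summable_norm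
        (by simpa using hF))]
    simp
  simp_rw [hGy]
  have h1 := AddCircle.intervalIntegral_preimage 1 0 (fun t : UnitAddCircle => ‖G t‖ ^ 2)
  rw [zero_add] at h1
  rw [h1, AddCircle.volume_eq_smul_haarAddCircle, ENNReal.ofReal_one, one_smul]
  refine integral_congr_ae ?_
  filter_upwards [ContinuousMap.coeFn_toLp (p := 2) (𝕜 := ℂ) AddCircle.haarAddCircle G] with t ht
  rw [ht]

theorem tsum_setLIntegral_Ioc_comp_add_int {φ : ℝ → ℝ≥0∞} :
    ∑' k : ℤ, ∫⁻ y in Ioc (0 : ℝ) 1, φ (y + k) = ∫⁻ y, φ y := by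
  have h (k : ℤ) : ∫⁻ y in Ioc (0 : ℝ) 1, φ (y + k) = ∫⁻ y in Ioc (k : ℝ) (k + 1), φ y := by
    have := (measurePreserving_add_right volume (k : ℝ)).setLIntegral_comp_preimage_emb
      (measurableEmbedding_addRight (k : ℝ)) φ (Ioc (k : ℝ) (k + 1))
    rw [← this]
    simp
  simp_rw [h]
  rw [← lintegral_iUnion (fun _ => measurableSet_Ioc) (pairwise_disjoint_Ioc_intCast ℝ),
    iUnion_Ioc_intCast, setLIntegral_univ]

theorem sq_tsum_mul_le {ι : Type*} (a w : ι → ℝ≥0∞) :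
    (∑' i, a i * w i) ^ 2 ≤ (∑' i, w i) * ∑' i, a i ^ 2 * w i := by
  let _ : MeasurableSpace ι := ⊤
  have h := ENNReal.lintegral_mul_norm_pow_le (μ := Measure.count)
    (measurable_from_top (f := w)).aemeasurable
    (measurable_from_top (f := fun i => a i ^ 2 * w i)).aemeasurable
    (p := 1 / 2) (q := 1 / 2) (by norm_num) (by norm_num) (by norm_num)
  have hsq (x : ℝ≥0∞) : (x ^ (1 / 2 : ℝ)) ^ 2 = x := by
    rw [← ENNReal.rpow_natCast, ← ENNReal.rpow_mul]; norm_num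
  have hpt (i : ι) : w i ^ (1 / 2 : ℝ) * (a i ^ 2 * w i) ^ (1 / 2 : ℝ) = a i * w i := by
    rw [← ENNReal.mul_rpow_of_nonneg _ _ (by norm_num),
      show w i * (a i ^ 2 * w i) = (a i * w i) ^ 2 by ring, ← ENNReal.rpow_natCast,
      ← ENNReal.rpow_mul]
    norm_num
  simp_rw [hpt, lintegral_count] at h
  calc _ ≤ _ := pow_le_pow_left' h 2
    _ = _ := by rw [mul_pow, hsq, hsq]

theorem SchwartzMap.exists_tsum_enorm_comp_add_int_le (Ψ : SchwartzMap ℝ ℂ) :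
    ∃ A : ℝ≥0∞, A ≠ ∞ ∧ ∀ y ∈ Ioc (0 : ℝ) 1, ∑' k : ℤ, ‖Ψ (y + k)‖ₑ ≤ A := by
  have hs := summable_norm_restrict_comp_addRight (F := ⟨Ψ, Ψ.continuous⟩) one_lt_two
    (Ψ.isBigO_cocompact_rpow (-2)) ⟨Icc 0 1, isCompact_Icc⟩
  refine ⟨_, hs.tsum_ofReal_ne_top, fun y hy => ENNReal.tsum_le_tsum fun k => ?_⟩
  rw [← ofReal_norm]
  exact ENNReal.ofReal_le_ofReal (ContinuousMap.norm_coe_le_norm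
    (((⟨Ψ, Ψ.continuous⟩ : C(ℝ, ℂ)).comp (ContinuousMap.addRight (k : ℝ))).restrict (Icc 0 1))
    ⟨y, Ioc_subset_Icc_self hy⟩)

theorem ofReal_tsum_sq_norm_integral_mul_exp_le {Ψ : SchwartzMap ℝ ℂ} {A : ℝ≥0∞}
    (hA : ∀ y ∈ Ioc (0 : ℝ) 1, ∑' k : ℤ, ‖Ψ (y + k)‖ₑ ≤ A) {a : ℝ → ℂ} (ha : Continuous a)
    {C : ℝ} (hC : ∀ y, ‖a y‖ ≤ C) :
    ENNReal.ofReal (∑' n : ℤ,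
      ‖∫ y : ℝ, a y * Complex.exp (((2 * Real.pi * (n : ℝ) * y : ℝ) : ℂ) * Complex.I) *
        Ψ y‖ ^ 2) ≤ A * ∫⁻ y, ‖a y‖ₑ ^ 2 * ‖Ψ y‖ₑ := by
  let F : C(ℝ, ℂ) := ⟨fun y => a y * Ψ y, ha.mul Ψ.continuous⟩
  have hFO : F =O[cocompact ℝ] fun x : ℝ => |x| ^ (-2 : ℝ) :=
    (IsBigO.of_bound C (Eventually.of_forall fun y => by
      change ‖a y * Ψ y‖ ≤ C * ‖Ψ y‖
      rw [norm_mul]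
      gcongr
      exact hC y)).trans (Ψ.isBigO_cocompact_rpow (-2))
  have hsum := hasSum_sq_norm_fourier_int (summable_norm_restrict_comp_addRight one_lt_two hFO)
  have hcoeff (n : ℤ) : ∫ y : ℝ, a y *
      Complex.exp (((2 * Real.pi * (n : ℝ) * y : ℝ) : ℂ) * Complex.I) * Ψ y =
      𝓕 (F : ℝ → ℂ) ((-n : ℤ) : ℝ) := by
    rw [Real.fourier_real_eq_integral_exp_smul]
    congr 1 with y
    change _ = _ • (a y * Ψ y)
    rw [smul_eq_mul, mul_right_comm, mul_comm]
    congr 3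
    push_cast
    ring
  simp_rw [hcoeff]
  have hneg := (Equiv.neg ℤ).tsum_eq (fun n : ℤ => ‖𝓕 (F : ℝ → ℂ) n‖ ^ 2)
  simp only [Equiv.neg_apply] at hneg
  rw [hneg, hsum.tsum_eq, intervalIntegral.integral_of_le zero_le_one]
  calc ENNReal.ofReal (∫ y in Ioc (0 : ℝ) 1, ‖∑' k : ℤ, F (y + k)‖ ^ 2)
      ≤ ∫⁻ y in Ioc (0 : ℝ) 1, ENNReal.ofReal (‖∑' k : ℤ, F (y + k)‖ ^ 2) :=
        (ENNReal.ofReal_le_ofReal (le_norm_self _)).trans <| by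
          rw [ofReal_norm]
          refine (enorm_integral_le_lintegral_enorm _).trans_eq (lintegral_congr fun y => ?_)
          exact Real.enorm_of_nonneg (by positivity)
    _ ≤ ∫⁻ y in Ioc (0 : ℝ) 1, A * ∑' k : ℤ, ‖a (y + k)‖ₑ ^ 2 * ‖Ψ (y + k)‖ₑ := by
        refine setLIntegral_mono' measurableSet_Ioc fun y hy => ?_
        rw [ENNReal.ofReal_pow (norm_nonneg _), ofReal_norm]
        calc ‖∑' k : ℤ, F (y + k)‖ₑ ^ 2
            ≤ (∑' k : ℤ, ‖a (y + k)‖ₑ * ‖Ψ (y + k)‖ₑ) ^ 2 := by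
              refine pow_le_pow_left' (enorm_tsum_le_tsum_enorm.trans_eq ?_) 2
              exact tsum_congr fun k => enorm_mul _ _
          _ ≤ _ := sq_tsum_mul_le _ _
          _ ≤ _ := by gcongr; exact hA y hy
    _ = A * ∫⁻ y, ‖a y‖ₑ ^ 2 * ‖Ψ y‖ₑ := by
        have hm (k : ℤ) : Measurable fun y : ℝ => ‖a (y + k)‖ₑ ^ 2 * ‖Ψ (y + k)‖ₑ := by
          have := ha.measurable
          have := Ψ.continuous.measurable
          fun_prop
        rw [lintegral_const_mul _ (Measurable.tsum hm),
          lintegral_tsum fun k => (hm k).aemeasurable,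
          tsum_setLIntegral_Ioc_comp_add_int (φ := fun y => ‖a y‖ₑ ^ 2 * ‖Ψ y‖ₑ)]

end Periodization

theorem lintegral_sq_enorm_eq_sq_eLpNorm {α E : Type*} [MeasurableSpace α] {μ : Measure α}
    [NormedAddCommGroup E] (h : α → E) : ∫⁻ x, ‖h x‖ₑ ^ 2 ∂μ = eLpNorm h 2 μ ^ 2 := by
  simpa using (eLpNorm_nnreal_pow_eq_lintegral (f := h) (μ := μ) (p := 2) two_ne_zero).symm

theorem eLpNorm_two_comp_sub_mul_comp_add_le {p q : ℝ≥0∞} [ENNReal.HolderTriple p q 2]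
    {f g : ℝ → ℂ} (hf : Continuous f) (hg : Continuous g) (y : ℝ) :
    eLpNorm (fun x => f (x - y) * g (x + y)) 2 volume ≤
      eLpNorm f p volume * eLpNorm g q volume := by
  rw [← eLpNorm_comp_measurePreserving hf.aestronglyMeasurable (measurePreserving_sub_right _ y),
    ← eLpNorm_comp_measurePreserving hg.aestronglyMeasurable (measurePreserving_add_right _ y)]
  exact eLpNorm_smul_le_mul_eLpNorm (𝕜 := ℂ) (hg.comp (by fun_prop)).aestronglyMeasurable
    (hf.comp (by fun_prop)).aestronglyMeasurable

/-- **Lacey.** For `p, q ∈ [2,∞]` with `1/p + 1/q = 1/2` and `Ψ`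
Schwartz with Fourier support in `[-1,1]`, the modulated smooth bilinear square
function maps `L^p × L^q` into `L²`. -/
theorem lacey_bilinear_modulated_square_function
    (p q : ℝ≥0∞) (hp : 2 ≤ p) (hq : 2 ≤ q) (hpq : 1 / p + 1 / q = 1 / 2)
    (Ψ : SchwartzMap ℝ ℂ) (hΨ : Function.support (FT ⇑Ψ) ⊆ Set.Icc (-1 : ℝ) 1) :
    ∃ c : ℝ, 0 < c ∧ ∀ f g : SchwartzMap ℝ ℂ,
      eLpNorm (fun x : ℝ =>
          Real.sqrt (∑' n : ℤ,
            ‖∫ y : ℝ, f (x - y) * g (x + y) *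
                Complex.exp (((2 * Real.pi * (n : ℝ) * y : ℝ) : ℂ) * Complex.I) *
                Ψ y‖ ^ 2))
          2 volume ≤
        ENNReal.ofReal c * eLpNorm (⇑f) p volume * eLpNorm (⇑g) q volume := by
  obtain ⟨A, hA, hAΨ⟩ := Ψ.exists_tsum_enorm_comp_add_int_le
  have : ENNReal.HolderTriple p q 2 := ⟨by simpa using hpq⟩
  set B : ℝ≥0∞ := ∫⁻ y, ‖Ψ y‖ₑ
  have hB' : B ≠ ∞ := (Ψ.integrable (μ := volume)).hasFiniteIntegral.ne
  have hAB : A * B ≤ ENNReal.ofReal ((A * B).toReal + 1) ^ 2 := by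
    have h1 : A * B ≤ ENNReal.ofReal ((A * B).toReal + 1) := by
      rw [ENNReal.le_ofReal_iff_toReal_le (ENNReal.mul_ne_top hA hB') (by positivity)]
      linarith
    refine h1.trans (le_self_pow₀ ?_ two_ne_zero)
    rw [ENNReal.one_le_ofReal]
    linarith [(A * B).toReal_nonneg]
  refine ⟨(A * B).toReal + 1, by positivity, fun f g => ?_⟩
  obtain ⟨Cf, -, hCf⟩ := f.decay 0 0
  obtain ⟨Cg, -, hCg⟩ := g.decay 0 0
  simp only [pow_zero, one_mul, norm_iteratedFDeriv_zero] at hCf hCg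
  rw [← ENNReal.pow_le_pow_left_iff two_ne_zero, ← lintegral_sq_enorm_eq_sq_eLpNorm]
  calc _ ≤ ∫⁻ x, A * ∫⁻ y, ‖f (x - y) * g (x + y)‖ₑ ^ 2 * ‖Ψ y‖ₑ := by
        refine lintegral_mono fun x => ?_
        rw [← ofReal_norm, ← ENNReal.ofReal_pow (norm_nonneg _), norm_of_nonneg (sqrt_nonneg _),
          sq_sqrt (tsum_nonneg fun _ => by positivity)]
        refine ofReal_tsum_sq_norm_integral_mul_exp_le hAΨ
          (a := fun y => f (x - y) * g (x + y)) (C := Cf * Cg) (by fun_prop) fun y => ?_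
        rw [norm_mul]
        exact mul_le_mul (hCf _) (hCg _) (norm_nonneg _) ((norm_nonneg _).trans (hCf 0))
    _ = A * ∫⁻ y, (∫⁻ x, ‖f (x - y) * g (x + y)‖ₑ ^ 2) * ‖Ψ y‖ₑ := by
        rw [lintegral_const_mul' _ _ hA, lintegral_lintegral_swap]
        · congr 1
          exact lintegral_congr fun y => lintegral_mul_const' _ _ enorm_ne_top
        · have := f.continuous.measurable
          have := g.continuous.measurable
          have := Ψ.continuous.measurable
          exact Measurable.aemeasurable (by fun_prop)
    _ ≤ A * ∫⁻ y, (eLpNorm f p volume * eLpNorm g q volume) ^ 2 * ‖Ψ y‖ₑ := by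
        gcongr with y
        rw [lintegral_sq_enorm_eq_sq_eLpNorm]
        exact pow_le_pow_left'
          (eLpNorm_two_comp_sub_mul_comp_add_le f.continuous g.continuous y) 2
    _ = A * B * (eLpNorm f p volume * eLpNorm g q volume) ^ 2 := by
        rw [lintegral_const_mul _ Ψ.continuous.enorm.measurable]
        ring
    _ ≤ _ := by
        rw [mul_assoc (ENNReal.ofReal _), mul_pow (ENNReal.ofReal _)]
        gcongr
end
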